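/- arXiv:2309.07793 — 11 statements merged into one kernel-verified Lean document; each statement's English description precedes it below -/
import Mathlib

section
/- Fix an integer m ≥ 2 and a point x ∈ C_m all of whose coordinates are positive. Then there exists an Apéry point y of C_m with E(y) = E(x) if and only if every integer vector v ∈ ℤ^{A(x)} lying in the ℚ-linear span of the presentation lattice L(x) satisfies Σ_{a ∈ A(x)} v_a · a = 0 in ℤ/mℤ (i.e., v · α ≡ 0 (mod m), where α is the vector whose entries are the atoms of x taken as integers in {1, …, m−1}). -/
open scoped BigOperators

/-- The Kunz cone `C_m`: points indexed by residues modulo `m` (the coordinate at `0` is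
ignored) satisfying `x i + x j ≥ x (i+j)` for nonzero `i, j` with `i + j ≠ 0`. -/
def KunzCone (m : ℕ) : Set (ZMod m → ℝ) :=
  {x | ∀ i j : ZMod m, i ≠ 0 → j ≠ 0 → i + j ≠ 0 → x (i + j) ≤ x i + x j}

/-- The equality set `E(x)` of a point of the Kunz cone. -/
def EqualitySet (m : ℕ) (x : ZMod m → ℝ) : Set (ZMod m × ZMod m) :=
  {p | p.1 ≠ 0 ∧ p.2 ≠ 0 ∧ p.1 + p.2 ≠ 0 ∧ x p.1 + x p.2 = x (p.1 + p.2)}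

/-- An Apéry point of `C_m`: a point of the cone with integer coordinates with
`y i ≡ i (mod m)` for every nonzero `i`. -/
def IsAperyPoint (m : ℕ) (y : ZMod m → ℝ) : Prop :=
  y ∈ KunzCone m ∧ ∀ i : ZMod m, i ≠ 0 → ∃ z : ℤ, y i = (z : ℝ) ∧ (z : ZMod m) = i

/-- The atoms `A(x)` of a point of the Kunz cone with positive coordinates. -/
def KunzAtoms (m : ℕ) (x : ZMod m → ℝ) : Set (ZMod m) :=
  {a | a ≠ 0 ∧ ∀ i j : ZMod m, i ≠ 0 → j ≠ 0 → i + j = a → x i + x j ≠ x a}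

/-- `e(x)`, the number of atoms. -/
noncomputable def kunzE (m : ℕ) (x : ZMod m → ℝ) : ℕ := (KunzAtoms m x).ncard

/-- The normal vector `e_i + e_j - e_{i+j}` of a supporting hyperplane of the Kunz cone. -/
def hypVec (m : ℕ) (i j : ZMod m) : ZMod m → ℚ :=
  Pi.single i 1 + Pi.single j 1 - Pi.single (i + j) 1

/-- `d(x)`, the dimension of the face of `C_m` whose relative interior contains `x`. -/
noncomputable def kunzD (m : ℕ) (x : ZMod m → ℝ) : ℕ :=
  (m - 1) - Module.finrank ℚ (Submodule.span ℚ
    {v : ZMod m → ℚ | ∃ p ∈ EqualitySet m x, v = hypVec m p.1 p.2})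

/-- `z : ℕ^{A(x)}` is a factorization of the nonzero residue `a`. -/
def IsKunzFactorization (m : ℕ) [NeZero m] (x : ZMod m → ℝ) (a : ZMod m)
    (z : ZMod m → ℕ) : Prop :=
  (∀ c, z c ≠ 0 → c ∈ KunzAtoms m x) ∧
  (∑ c : ZMod m, (z c : ZMod m) * c) = a ∧
  (∑ c : ZMod m, (z c : ℝ) * x c) = x a

/-- `Z(a)`, the set of factorizations of `a`. -/
def KunzFactorizations (m : ℕ) [NeZero m] (x : ZMod m → ℝ) (a : ZMod m) :
    Set (ZMod m → ℕ) :=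
  {z | IsKunzFactorization m x a z}

/-- The presentation lattice `L(x)`: the subgroup of `ℤ^{A(x)}` generated by all differences
of pairs of factorizations of a common nonzero residue. -/
def PresentationLattice (m : ℕ) [NeZero m] (x : ZMod m → ℝ) :
    AddSubgroup (ZMod m → ℤ) :=
  AddSubgroup.closure {v | ∃ a : ZMod m, a ≠ 0 ∧ ∃ z z',
    z ∈ KunzFactorizations m x a ∧ z' ∈ KunzFactorizations m x a ∧
    v = fun c => (z c : ℤ) - (z' c : ℤ)}

open Filter Topology in
/-- The rounding `⌊n r⌋ / n` of a real number `r` tends to `r`. -/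
theorem tendsto_intFloor_natCast_mul_div (r : ℝ) :
    Tendsto (fun n : ℕ => (⌊(n : ℝ) * r⌋ : ℝ) / n) atTop (𝓝 r) := by
  have hlow : Tendsto (fun n : ℕ => r - 1 / (n : ℝ)) atTop (𝓝 r) := by
    simpa using tendsto_const_nhds.sub (tendsto_one_div_atTop_nhds_zero_nat (𝕜 := ℝ))
  refine tendsto_of_tendsto_of_tendsto_of_le_of_le' hlow tendsto_const_nhds ?_ ?_
  · filter_upwards [eventually_gt_atTop 0] with n hn
    have hn' : (0 : ℝ) < n := by exact_mod_cast hn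
    rw [le_div_iff₀ hn', sub_mul, one_div_mul_cancel hn'.ne']
    linarith [Int.lt_floor_add_one ((n : ℝ) * r)]
  · filter_upwards [eventually_gt_atTop 0] with n hn
    have hn' : (0 : ℝ) < n := by exact_mod_cast hn
    rw [div_le_iff₀ hn']
    linarith [Int.floor_le ((n : ℝ) * r)]

open Filter Topology in
/-- On a free `ℤ`-module of finite rank, a functional to `ℤ/mℤ` lifts to an integral functional
that is positive on any given finite set on which some real functional is positive. -/
theorem exists_int_lift_pos {M : Type*} [AddCommGroup M] [Module.Finite ℤ M] [Module.Free ℤ M]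
    (m : ℕ) [NeZero m] (φ : M →ₗ[ℤ] ZMod m) (X : M →ₗ[ℤ] ℝ) {S : Set M} (hS : S.Finite)
    (hX : ∀ w ∈ S, 0 < X w) :
    ∃ Y : M →ₗ[ℤ] ℤ, (∀ w, ((Y w : ℤ) : ZMod m) = φ w) ∧ ∀ w ∈ S, 0 < Y w := by
  let b := Module.Free.chooseBasis ℤ M
  have hm : (0 : ℝ) < m := by exact_mod_cast Nat.pos_of_ne_zero (NeZero.ne m)
  let s : Module.Free.ChooseBasisIndex ℤ M → ℤ := fun k => (φ (b k)).val
  let Y : ℕ → M →ₗ[ℤ] ℤ := fun n => b.constr ℤ fun k => s k + m * ⌊(n : ℝ) * X (b k)⌋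
  have hYapply : ∀ n w, Y n w = ∑ k, b.repr w k * (s k + m * ⌊(n : ℝ) * X (b k)⌋) := by
    intro n w
    simp [Y, Module.Basis.constr_apply_fintype]
  have hYmod : ∀ n w, ((Y n w : ℤ) : ZMod m) = φ w := by
    intro n w
    conv_rhs => rw [← b.sum_repr w]
    simp only [map_sum, map_zsmul, zsmul_eq_mul]
    rw [hYapply]
    simp [s]
  have hlim : ∀ w, Tendsto (fun n : ℕ => (Y n w : ℝ) / n) atTop (𝓝 (m * X w)) := by
    intro w
    have hterm : ∀ k, Tendsto
        (fun n : ℕ => (b.repr w k : ℝ) * ((s k : ℝ) / n + m * ((⌊(n : ℝ) * X (b k)⌋ : ℝ) / n)))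
        atTop (𝓝 ((b.repr w k : ℝ) * (0 + m * X (b k)))) := fun k =>
      ((tendsto_const_div_atTop_nhds_zero_nat _).add
        ((tendsto_intFloor_natCast_mul_div _).const_mul _)).const_mul _
    convert tendsto_finsetSum Finset.univ fun k _ => hterm k using 2
    · rw [hYapply]
      push_cast
      rw [Finset.sum_div]
      exact Finset.sum_congr rfl fun k _ => by ring
    · conv_lhs => rw [← b.sum_repr w]
      simp only [map_sum, map_zsmul, zsmul_eq_mul, Finset.mul_sum]
      exact Finset.sum_congr rfl fun k _ => by ring
  have hev : ∀ᶠ n : ℕ in atTop, ∀ w ∈ S, 0 < (Y n w : ℝ) / n :=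
    (eventually_all_finite hS).2 fun w hw =>
      (hlim w).eventually (lt_mem_nhds (mul_pos hm (hX w hw)))
  obtain ⟨n, hn, hn0⟩ := (hev.and (eventually_gt_atTop 0)).exists
  refine ⟨Y n, hYmod n, fun w hw => ?_⟩
  have hn' : (0 : ℝ) < n := by exact_mod_cast hn0
  exact_mod_cast (div_pos_iff_of_pos_right hn').1 (hn w hw)

/-- If `x` is subadditive and `y` is additive wherever `x` is, then this extends from two summands
to arbitrary `ℕ`-linear combinations. -/
theorem sum_natCast_mul_of_subadditive {G : Type*} [AddCommMonoid G] [Fintype G] {x y : G → ℝ}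
    (hx0 : x 0 = 0) (hy0 : y 0 = 0) (hx : ∀ i j, x (i + j) ≤ x i + x j)
    (hxy : ∀ i j, x i + x j = x (i + j) → y i + y j = y (i + j)) (z : G → ℕ) :
    x (∑ c, z c • c) ≤ ∑ c, (z c : ℝ) * x c ∧
      (∑ c, (z c : ℝ) * x c = x (∑ c, z c • c) →
        ∑ c, (z c : ℝ) * y c = y (∑ c, z c • c)) := by
  let P : AddSubmonoid (G × ℝ × ℝ) :=
    { carrier := {p | x p.1 ≤ p.2.1 ∧ (p.2.1 = x p.1 → p.2.2 = y p.1)}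
      zero_mem' := by simp [hx0, hy0]
      add_mem' := by
        rintro ⟨g, r, t⟩ ⟨g', r', t'⟩ ⟨h1, h2⟩ ⟨h1', h2'⟩
        simp only [Set.mem_ofPred_eq, Prod.mk_add_mk] at *
        have hg := hx g g'
        refine ⟨by linarith, fun h => ?_⟩
        rw [h2 (by linarith), h2' (by linarith)]
        exact hxy _ _ (by linarith) }
  have hmem : ∑ c, z c • ((c, x c, y c) : G × ℝ × ℝ) ∈ P :=
    P.sum_mem fun c _ => P.nsmul_mem ⟨le_rfl, fun _ => rfl⟩ _
  have hsum : ∑ c, z c • ((c, x c, y c) : G × ℝ × ℝ) =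
      (∑ c, z c • c, ∑ c, (z c : ℝ) * x c, ∑ c, (z c : ℝ) * y c) := by
    simp [Prod.ext_iff, Prod.fst_sum, Prod.snd_sum]
  rw [hsum] at hmem
  exact hmem

section Kunz

variable {m : ℕ} [NeZero m] {x : ZMod m → ℝ}

/-- A factorization of `a` with respect to `x` evaluates to `y a` at every `y` that satisfies the
same equalities as `x`. -/
theorem IsKunzFactorization.sum_mul_eq (hx : x ∈ KunzCone m)
    (hpos : ∀ i : ZMod m, i ≠ 0 → 0 < x i) {y : ZMod m → ℝ} (hy0 : y 0 = 0)
    (hxy : EqualitySet m x ⊆ EqualitySet m y) {a : ZMod m} (ha : a ≠ 0) {z : ZMod m → ℕ}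
    (hz : IsKunzFactorization m x a z) : ∑ c, (z c : ℝ) * y c = y a := by
  obtain ⟨hz1, hz2, hz3⟩ := hz
  have hz0 : z 0 = 0 := by
    by_contra h
    exact (hz1 0 h).1 rfl
  let x' : ZMod m → ℝ := Function.update x 0 0
  have hx'0 : x' 0 = 0 := by simp [x']
  have hx' : ∀ i, i ≠ 0 → x' i = x i := fun i hi => by simp [x', hi]
  have key := sum_natCast_mul_of_subadditive (x := x') (y := y) hx'0 hy0 ?_ ?_ z
  · simp only [nsmul_eq_mul, hz2] at key
    refine key.2 ?_
    rw [hx' a ha, ← hz3]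
    refine Finset.sum_congr rfl fun c _ => ?_
    rcases eq_or_ne c 0 with rfl | hc
    · simp [hz0]
    · rw [hx' c hc]
  · intro i j
    rcases eq_or_ne i 0 with rfl | hi
    · simp [hx'0]
    rcases eq_or_ne j 0 with rfl | hj
    · simp [hx'0]
    rcases eq_or_ne (i + j) 0 with hij | hij
    · rw [hij, hx'0, hx' i hi, hx' j hj]
      linarith [hpos i hi, hpos j hj]
    · rw [hx' i hi, hx' j hj, hx' _ hij]
      exact hx i j hi hj hij
  · intro i j h
    rcases eq_or_ne i 0 with rfl | hi
    · simp [hy0]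
    rcases eq_or_ne j 0 with rfl | hj
    · simp [hy0]
    rcases eq_or_ne (i + j) 0 with hij | hij
    · rw [hij, hx'0, hx' i hi, hx' j hj] at h
      linarith [hpos i hi, hpos j hj]
    · rw [hx' i hi, hx' j hj, hx' _ hij] at h
      exact (hxy (show (i, j) ∈ EqualitySet m x from ⟨hi, hj, hij, h⟩)).2.2.2

theorem IsKunzFactorization.add {i j : ZMod m} {z w : ZMod m → ℕ}
    (hz : IsKunzFactorization m x i z) (hw : IsKunzFactorization m x j w)
    (h : x i + x j = x (i + j)) : IsKunzFactorization m x (i + j) (z + w) := by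
  refine ⟨fun c hc => ?_, ?_, ?_⟩
  · by_cases h0 : z c = 0
    · exact hw.1 c fun h1 => hc (by simp [h0, h1])
    · exact hz.1 c h0
  · simp [add_mul, Finset.sum_add_distrib, hz.2.1, hw.2.1]
  · simp [add_mul, Finset.sum_add_distrib, hz.2.2, hw.2.2, h]

/-- Every nonzero residue has a factorization. -/
theorem exists_isKunzFactorization (hpos : ∀ i : ZMod m, i ≠ 0 → 0 < x i) (a : ZMod m)
    (ha : a ≠ 0) : ∃ z, IsKunzFactorization m x a z := by
  have hwf : WellFounded fun i j : ZMod m => x i < x j :=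
    (Finite.wellFounded_of_trans_of_irrefl (Function.onFun (· < ·) x))
  induction a using hwf.induction with
  | _ a ih =>
    by_cases hA : a ∈ KunzAtoms m x
    · refine ⟨Pi.single a 1, fun c hc => ?_, ?_, ?_⟩
      · rcases eq_or_ne c a with rfl | hca
        · exact hA
        · simp [hca] at hc
      · simp [Pi.single_apply]
      · simp [Pi.single_apply]
    · simp only [KunzAtoms, Set.mem_ofPred_eq, not_and, not_forall, not_not] at hA
      obtain ⟨i, j, hi, hj, rfl, h⟩ := hA ha
      obtain ⟨z, hz⟩ := ih i (by linarith [hpos j hj]) hi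
      obtain ⟨w, hw⟩ := ih j (by linarith [hpos i hi]) hj
      exact ⟨z + w, hz.add hw h⟩

/-- A point that takes the same value on all factorizations of each residue vanishes on the
rational span of the presentation lattice. -/
theorem sum_intCast_mul_eq_zero_of_mem_span {t : ZMod m → ℝ}
    (ht : ∀ a : ZMod m, a ≠ 0 → ∀ z, IsKunzFactorization m x a z → ∑ c, (z c : ℝ) * t c = t a)
    {v : ZMod m → ℤ}
    (hv : (fun c => (v c : ℚ)) ∈ Submodule.span ℚ
      ((fun w : ZMod m → ℤ => fun c => (w c : ℚ)) ''
        (PresentationLattice m x : Set (ZMod m → ℤ)))) :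
    ∑ c, (v c : ℝ) * t c = 0 := by
  have hL : PresentationLattice m x ≤
      (Fintype.linearCombination ℤ t).toAddMonoidHom.ker := by
    refine (AddSubgroup.closure_le _).2 ?_
    rintro _ ⟨a, ha, z, z', hz, hz', rfl⟩
    have h1 := ht a ha z hz
    have h2 := ht a ha z' hz'
    simp [AddMonoidHom.mem_ker, Fintype.linearCombination_apply, sub_mul,
      Finset.sum_sub_distrib, h1, h2]
  have hspan : Submodule.span ℚ
      ((fun w : ZMod m → ℤ => fun c => (w c : ℚ)) ''
        (PresentationLattice m x : Set (ZMod m → ℤ))) ≤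
      LinearMap.ker (Fintype.linearCombination ℚ t) := by
    refine Submodule.span_le.2 ?_
    rintro _ ⟨w, hw, rfl⟩
    have h := hL hw
    simpa [AddMonoidHom.mem_ker, Fintype.linearCombination_apply, Rat.smul_def] using h
  have h := hspan hv
  simpa [Fintype.linearCombination_apply, Rat.smul_def] using h

/-- The saturation of the presentation lattice: the integer vectors in its rational span. -/
noncomputable def saturatedPresentationLattice (m : ℕ) [NeZero m] (x : ZMod m → ℝ) :
    Submodule ℤ (ZMod m → ℤ) :=
  ((Submodule.span ℚ ((fun w : ZMod m → ℤ => fun c => (w c : ℚ)) ''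
    (PresentationLattice m x : Set (ZMod m → ℤ)))).restrictScalars ℤ).comap
      ((Int.castAddHom ℚ).toIntLinearMap.compLeft (ZMod m))

theorem mem_saturatedPresentationLattice {v : ZMod m → ℤ} :
    v ∈ saturatedPresentationLattice m x ↔
      (fun c => (v c : ℚ)) ∈ Submodule.span ℚ
        ((fun w : ZMod m → ℤ => fun c => (w c : ℚ)) ''
          (PresentationLattice m x : Set (ZMod m → ℤ))) :=
  Iff.rfl

theorem isTorsionFree_quotient_saturatedPresentationLattice :
    Module.IsTorsionFree ℤ ((ZMod m → ℤ) ⧸ saturatedPresentationLattice m x) := by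
  refine Module.IsTorsionFree.of_smul_eq_zero fun r w h => ?_
  obtain ⟨v, rfl⟩ := Submodule.Quotient.mk_surjective _ w
  rw [← Submodule.Quotient.mk_smul, Submodule.Quotient.mk_eq_zero,
    mem_saturatedPresentationLattice] at h
  by_cases hr : r = 0
  · exact Or.inl hr
  right
  rw [Submodule.Quotient.mk_eq_zero, mem_saturatedPresentationLattice]
  have hr' : (r : ℚ) ≠ 0 := by exact_mod_cast hr
  convert Submodule.smul_mem _ (r : ℚ)⁻¹ h using 1
  funext c
  simp [hr']

theorem exists_isAperyPoint_of_forall_mem_span (hx : x ∈ KunzCone m)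
    (hpos : ∀ i : ZMod m, i ≠ 0 → 0 < x i)
    (H : ∀ v ∈ saturatedPresentationLattice m x, (∑ c : ZMod m, (v c : ZMod m) * c) = 0) :
    ∃ y, IsAperyPoint m y ∧ EqualitySet m y = EqualitySet m x := by
  have htf := isTorsionFree_quotient_saturatedPresentationLattice (m := m) (x := x)
  let L := saturatedPresentationLattice m x
  let φ : ((ZMod m → ℤ) ⧸ L) →ₗ[ℤ] ZMod m :=
    L.liftQ (Fintype.linearCombination ℤ (id : ZMod m → ZMod m)) fun v hv => by
      simpa [Fintype.linearCombination_apply] using H v hv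
  let X : ((ZMod m → ℤ) ⧸ L) →ₗ[ℤ] ℝ :=
    L.liftQ (Fintype.linearCombination ℤ x) fun v hv => by
      have h := sum_intCast_mul_eq_zero_of_mem_span (t := x) (fun a _ z hz => hz.2.2) hv
      simpa [Fintype.linearCombination_apply] using h
  choose! f hf using exists_isKunzFactorization hpos
  let g : ZMod m → (ZMod m → ℤ) ⧸ L := fun a => L.mkQ fun c => (f a c : ℤ)
  have hφ : ∀ a, a ≠ 0 → φ (g a) = a := fun a ha => by
    simpa [φ, g, Fintype.linearCombination_apply] using (hf a ha).2.1
  have hX : ∀ a, a ≠ 0 → X (g a) = x a := fun a ha => by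
    simpa [X, g, Fintype.linearCombination_apply] using (hf a ha).2.2
  have hg : ∀ i j, i ≠ 0 → j ≠ 0 → i + j ≠ 0 → x i + x j = x (i + j) →
      g i + g j = g (i + j) := by
    intro i j hi hj hij h
    rw [← sub_eq_zero]
    simp only [g, ← map_add, ← map_sub]
    rw [Submodule.mkQ_apply, Submodule.Quotient.mk_eq_zero]
    refine mem_saturatedPresentationLattice.2 (Submodule.subset_span ⟨_, ?_, rfl⟩)
    refine AddSubgroup.subset_closure
      ⟨i + j, hij, f i + f j, f (i + j), (hf i hi).add (hf j hj) h, hf _ hij, ?_⟩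
    funext c
    simp
  let S : Set ((ZMod m → ℤ) ⧸ L) :=
    (fun p : ZMod m × ZMod m => g p.1 + g p.2 - g (p.1 + p.2)) ''
      {p | p.1 ≠ 0 ∧ p.2 ≠ 0 ∧ p.1 + p.2 ≠ 0 ∧ x (p.1 + p.2) < x p.1 + x p.2}
  obtain ⟨Y, hYmod, hYpos⟩ := exists_int_lift_pos m φ X (S := S) ((Set.toFinite _).image _) (by
    rintro _ ⟨⟨i, j⟩, ⟨hi, hj, hij, h⟩, rfl⟩
    simp only at hi hj hij h
    simp only [map_sub, map_add, hX i hi, hX j hj, hX _ hij]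
    linarith)
  have hYeq : ∀ i j, i ≠ 0 → j ≠ 0 → i + j ≠ 0 → x i + x j = x (i + j) →
      (Y (g i) : ℝ) + Y (g j) = Y (g (i + j)) := by
    intro i j hi hj hij h
    rw [← hg i j hi hj hij h, map_add, Int.cast_add]
  have hYlt : ∀ i j, i ≠ 0 → j ≠ 0 → i + j ≠ 0 → x (i + j) < x i + x j →
      (Y (g (i + j)) : ℝ) < Y (g i) + Y (g j) := by
    intro i j hi hj hij h
    have hpos' := hYpos _ ⟨(i, j), ⟨hi, hj, hij, h⟩, rfl⟩
    simp only [map_sub, map_add] at hpos'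
    have hlt : Y (g (i + j)) < Y (g i) + Y (g j) := by linarith
    exact_mod_cast hlt
  refine ⟨fun a => Y (g a), ⟨fun i j hi hj hij => ?_, fun i hi => ⟨Y (g i), rfl, ?_⟩⟩, ?_⟩
  · rcases (hx i j hi hj hij).lt_or_eq with h | h
    · exact (hYlt i j hi hj hij h).le
    · exact (hYeq i j hi hj hij h.symm).ge
  · rw [hYmod, hφ i hi]
  · ext ⟨i, j⟩
    constructor
    · rintro ⟨hi, hj, hij, h⟩
      refine ⟨hi, hj, hij, ?_⟩
      by_contra hne
      exact (hYlt i j hi hj hij (lt_of_le_of_ne (hx i j hi hj hij) (Ne.symm hne))).ne h.symm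
    · rintro ⟨hi, hj, hij, h⟩
      exact ⟨hi, hj, hij, hYeq i j hi hj hij h⟩

theorem IsAperyPoint.sum_intCast_mul_eq_zero (hx : x ∈ KunzCone m)
    (hpos : ∀ i : ZMod m, i ≠ 0 → 0 < x i) {y : ZMod m → ℝ} (hy : IsAperyPoint m y)
    (hxy : EqualitySet m y = EqualitySet m x) {v : ZMod m → ℤ}
    (hv : v ∈ saturatedPresentationLattice m x) : (∑ c : ZMod m, (v c : ZMod m) * c) = 0 := by
  choose! k hky hkm using hy.2
  let k' : ZMod m → ℤ := Function.update k 0 0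
  have hk'0 : k' 0 = 0 := by simp [k']
  have hk'y : ∀ c, c ≠ 0 → (k' c : ℝ) = y c := fun c hc => by simp [k', hc, hky c hc]
  have hk'm : ∀ c, (k' c : ZMod m) = c := fun c => by
    rcases eq_or_ne c 0 with rfl | hc
    · simp [hk'0]
    · simp [k', hc, hkm c hc]
  have hsub : EqualitySet m x ⊆ EqualitySet m fun c => (k' c : ℝ) := by
    rw [← hxy]
    rintro ⟨i, j⟩ ⟨hi, hj, hij, h⟩
    refine ⟨hi, hj, hij, ?_⟩
    simp only at hi hj hij h ⊢
    rw [hk'y i hi, hk'y j hj, hk'y _ hij, h]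
  have h := sum_intCast_mul_eq_zero_of_mem_span (t := fun c => (k' c : ℝ))
    (fun a ha z hz => hz.sum_mul_eq hx hpos (by simp [hk'0]) hsub ha) hv
  have hint : ∑ c, v c * k' c = 0 := by exact_mod_cast h
  have hmod := congrArg (Int.cast : ℤ → ZMod m) hint
  simpa [hk'm] using hmod

end Kunz

/-- Theorem (main): a non-degenerate face of the Kunz cone is Apéry iff every integer vector
in the ℚ-span of the presentation lattice pairs to zero (mod m) with the vector of atoms. -/
theorem kunz_face_apery_iff_presentation_lattice (m : ℕ) (hm : 2 ≤ m) [NeZero m]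
    (x : ZMod m → ℝ) (hx : x ∈ KunzCone m) (hpos : ∀ i : ZMod m, i ≠ 0 → 0 < x i) :
    (∃ y, IsAperyPoint m y ∧ EqualitySet m y = EqualitySet m x) ↔
      ∀ v : ZMod m → ℤ,
        (fun c => (v c : ℚ)) ∈ Submodule.span ℚ
          ((fun w : ZMod m → ℤ => fun c => (w c : ℚ)) ''
            (PresentationLattice m x : Set (ZMod m → ℤ))) →
        (∑ c : ZMod m, (v c : ZMod m) * c) = 0 := by
  exact
    ⟨fun ⟨_, hy, hxy⟩ _ hv => hy.sum_intCast_mul_eq_zero hx hpos hxy hv,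
      exists_isAperyPoint_of_forall_mem_span hx hpos⟩
end

section
/- Fix an integer m ≥ 2 and a point x ∈ C_m all of whose coordinates are positive. Then there exists an Apéry point y of C_m with E(y) = E(x) if and only if every integer vector w ∈ ℤ^{m−1} lying in the ℚ-linear span of the set of vectors {e_i + e_j − e_{i+j} : (i, j) ∈ E(x)} satisfies Σ_{c} w_c · c = 0 in ℤ/mℤ, where the sum runs over the nonzero residues c (i.e., w · γ ≡ 0 (mod m) for γ = (1, 2, …, m−1)). -/
open scoped BigOperators

/-- A homomorphism to `ℤ` whose reduction mod `m` kills the kernel of a map `f` into a rational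
vector space can be changed, without changing its reduction, so as to kill that kernel itself. -/
theorem exists_intCast_eq_and_ker_le {A V : Type*} [AddCommGroup A] [Module.Finite ℤ A]
    [AddCommGroup V] [Module ℚ V] (m : ℕ) (f : A →ₗ[ℤ] V) (ψ : A →ₗ[ℤ] ℤ)
    (hψ : ∀ a, f a = 0 → (ψ a : ZMod m) = 0) :
    ∃ g : A →ₗ[ℤ] ℤ, (∀ a, f a = 0 → g a = 0) ∧ ∀ a, (g a : ZMod m) = ψ a := by
  have : Module.IsTorsionFree ℤ V := Module.IsTorsionFree.trans ℚ
  obtain ⟨s, hs⟩ := Module.projective_lifting_property f.rangeRestrict LinearMap.id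
    f.surjective_rangeRestrict
  refine ⟨ψ ∘ₗ s ∘ₗ f.rangeRestrict, fun a ha => ?_, fun a => ?_⟩
  · have : f.rangeRestrict a = 0 := Subtype.ext ha
    simp [this]
  · have h := congrArg Subtype.val (LinearMap.congr_fun hs (f.rangeRestrict a))
    have hk := hψ (s (f.rangeRestrict a) - a) (by simpa [sub_eq_zero] using h)
    simpa [sub_eq_zero] using hk

/-- A finitely generated subgroup of `ℝ` admits homomorphisms to `ℤ` that tend to infinity on
every positive element. -/
theorem exists_intLinearMap_tendsto_atTop (P : Submodule ℤ ℝ) [Module.Finite ℤ P] :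
    ∃ g : ℕ → (P →ₗ[ℤ] ℤ), ∀ p : P, 0 < (p : ℝ) →
      Filter.Tendsto (fun n => g n p) Filter.atTop Filter.atTop := by
  let b := Module.Free.chooseBasis ℤ P
  refine ⟨fun n => b.constr ℤ fun l => ⌊(n : ℝ) * b l⌋, fun p hp => ?_⟩
  rw [← tendsto_intCast_atTop_iff (R := ℝ)]
  have hlim : Filter.Tendsto (fun n : ℕ => (n : ℝ) * p - ∑ l, |(b.repr p l : ℝ)|)
      Filter.atTop Filter.atTop :=
    Filter.tendsto_atTop_add_const_right _ _
      (tendsto_natCast_atTop_atTop.atTop_mul_const hp)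
  refine Filter.tendsto_atTop_mono (fun n => ?_) hlim
  have hsum : (p : ℝ) = ∑ l, (b.repr p l : ℝ) * b l := by
    conv_lhs => rw [← b.sum_repr p]
    simp only [Submodule.coe_sum, Submodule.coe_smul, zsmul_eq_mul]
  rw [hsum, Finset.mul_sum, ← Finset.sum_sub_distrib, Module.Basis.constr_apply_fintype]
  push_cast [smul_eq_mul, Module.Basis.equivFun_apply]
  refine Finset.sum_le_sum fun l _ => ?_
  have h := le_abs_self ((b.repr p l : ℝ) * ((n : ℝ) * b l - ⌊(n : ℝ) * b l⌋))
  rw [abs_mul, Int.self_sub_floor, Int.abs_fract] at h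
  have h' := mul_le_mul_of_nonneg_left (Int.fract_lt_one ((n : ℝ) * b l)).le
    (abs_nonneg (b.repr p l : ℝ))
  rw [← Int.self_sub_floor] at h h'
  linarith

/-- An integer vector agreeing on nonzero residues with a point on the face of `x` is orthogonal
to the normal vectors of that face. -/
theorem sum_mul_eq_zero_of_mem_span_hypVec (m : ℕ) [NeZero m] (x : ZMod m → ℝ) (z : ZMod m → ℤ)
    (hz : ∀ p ∈ EqualitySet m x, z p.1 + z p.2 = z (p.1 + p.2)) (w : ZMod m → ℤ)
    (hw : (fun c => (w c : ℚ)) ∈ Submodule.span ℚ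
      {v : ZMod m → ℚ | ∃ p ∈ EqualitySet m x, v = hypVec m p.1 p.2}) :
    ∑ c, w c * z c = 0 := by
  have hle : Submodule.span ℚ {v : ZMod m → ℚ | ∃ p ∈ EqualitySet m x, v = hypVec m p.1 p.2} ≤
      LinearMap.ker (Fintype.linearCombination ℚ fun c => (z c : ℚ)) := by
    rw [Submodule.span_le]
    rintro _ ⟨p, hp, rfl⟩
    simp only [SetLike.mem_coe, LinearMap.mem_ker, hypVec, map_sub, map_add,
      Fintype.linearCombination_apply_single, one_smul]
    exact_mod_cast sub_eq_zero.2 (hz p hp)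
  have h := hle hw
  simp only [LinearMap.mem_ker, Fintype.linearCombination_apply, smul_eq_mul] at h
  exact_mod_cast h

/-- If every integer vector in the span of the normal vectors pairs to zero with the residues,
then the linear span of the face contains an integer vector with the Apéry congruences. -/
theorem exists_int_of_span_hypVec (m : ℕ) [NeZero m] (x : ZMod m → ℝ)
    (h : ∀ w : ZMod m → ℤ, (fun c => (w c : ℚ)) ∈ Submodule.span ℚ
      {v : ZMod m → ℚ | ∃ p ∈ EqualitySet m x, v = hypVec m p.1 p.2} →
      (∑ c : ZMod m, (w c : ZMod m) * c) = 0) :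
    ∃ z : ZMod m → ℤ, (∀ p ∈ EqualitySet m x, z p.1 + z p.2 = z (p.1 + p.2)) ∧
      ∀ c, (z c : ZMod m) = c := by
  let S := Submodule.span ℚ
    {v : ZMod m → ℚ | ∃ p ∈ EqualitySet m x, v = hypVec m p.1 p.2}
  let ι : (ZMod m → ℤ) →ₗ[ℤ] (ZMod m → ℚ) :=
    ((Int.castAddHom ℚ).compLeft (ZMod m)).toIntLinearMap
  obtain ⟨g, hg0, hg⟩ := exists_intCast_eq_and_ker_le m (S.mkQ.restrictScalars ℤ ∘ₗ ι)
    (Fintype.linearCombination ℤ fun c : ZMod m => (c.val : ℤ)) fun w hw => by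
      have := h w ((Submodule.Quotient.mk_eq_zero S).1 hw)
      simpa [Fintype.linearCombination_apply] using this
  refine ⟨fun c => g (Pi.single c 1), fun p hp => ?_, fun c => ?_⟩
  · have hι : ι (Pi.single p.1 1 + Pi.single p.2 1 - Pi.single (p.1 + p.2) 1) =
        hypVec m p.1 p.2 := by
      ext c
      simp [ι, hypVec, Pi.single_apply]
    have h0 := hg0 (Pi.single p.1 1 + Pi.single p.2 1 - Pi.single (p.1 + p.2) 1) <| by
      rw [LinearMap.comp_apply, hι]
      exact (Submodule.Quotient.mk_eq_zero S).2 (Submodule.subset_span ⟨p, hp, rfl⟩)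
    simpa [sub_eq_zero] using h0
  · simp [hg]

/-- A non-degenerate face of the Kunz cone is Apéry iff every integer vector in the ℚ-span
of the facet normal vectors `e_i + e_j - e_{i+j}`, for `(i,j)` in the equality set, pairs
to zero (mod m) with `γ = (1, 2, …, m-1)`. -/
theorem kunz_face_apery_iff_row_span (m : ℕ) (hm : 2 ≤ m) [NeZero m]
    (x : ZMod m → ℝ) (hx : x ∈ KunzCone m) (hpos : ∀ i : ZMod m, i ≠ 0 → 0 < x i) :
    (∃ y, IsAperyPoint m y ∧ EqualitySet m y = EqualitySet m x) ↔
      ∀ w : ZMod m → ℤ,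
        (fun c => (w c : ℚ)) ∈ Submodule.span ℚ
          {v : ZMod m → ℚ | ∃ p ∈ EqualitySet m x, v = hypVec m p.1 p.2} →
        (∑ c : ZMod m, (w c : ZMod m) * c) = 0 := by
  constructor
  · rintro ⟨y, ⟨-, hy⟩, hE⟩ w hw
    have hy' : ∀ i : ZMod m, ∃ z : ℤ, (i ≠ 0 → y i = z) ∧ (z : ZMod m) = i := fun i => by
      rcases eq_or_ne i 0 with rfl | hi
      · exact ⟨0, by simp⟩
      · obtain ⟨z, hz, hzi⟩ := hy i hi
        exact ⟨z, fun _ => hz, hzi⟩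
    choose z hz hzi using hy'
    have hsum := sum_mul_eq_zero_of_mem_span_hypVec m x z (fun p hp => by
      obtain ⟨h1, h2, h3, h4⟩ := hE ▸ hp
      rw [hz _ h1, hz _ h2, hz _ h3] at h4
      exact_mod_cast h4) w hw
    simpa [hzi] using congrArg (Int.cast : ℤ → ZMod m) hsum
  · intro h
    obtain ⟨z, hzE, hz⟩ := exists_int_of_span_hypVec m x h
    let P : Submodule ℤ ℝ := Submodule.span ℤ (Set.range x)
    have : Module.Finite ℤ P := Module.Finite.span_of_finite ℤ (Set.finite_range x)
    obtain ⟨g, hg⟩ := exists_intLinearMap_tendsto_atTop P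
    let X : ZMod m → P := fun c => ⟨x c, Submodule.subset_span ⟨c, rfl⟩⟩
    have hev : ∀ p : ZMod m × ZMod m, ∀ᶠ n in Filter.atTop, x (p.1 + p.2) < x p.1 + x p.2 →
        z (p.1 + p.2) - z p.1 - z p.2 < g n (X p.1 + X p.2 - X (p.1 + p.2)) ∧
          0 < g n (X p.1 + X p.2 - X (p.1 + p.2)) := fun p => by
      by_cases hp : x (p.1 + p.2) < x p.1 + x p.2
      · have ht := hg (X p.1 + X p.2 - X (p.1 + p.2)) (by simpa [X] using hp)
        filter_upwards [ht.eventually_gt_atTop _, ht.eventually_gt_atTop _] with n h1 h2 _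
        exact ⟨h1, h2⟩
      · simp [hp]
    obtain ⟨n, hn⟩ := (Filter.eventually_all.2 hev).exists
    let Y : ZMod m → ℤ := fun c => z c + m * g n (X c)
    have hlt : ∀ i j, x (i + j) < x i + x j → Y (i + j) < Y i + Y j := fun i j hij => by
      obtain ⟨h1, h2⟩ := hn (i, j) hij
      simp only [map_sub, map_add] at h1 h2
      have hm1 : (1 : ℤ) ≤ m := by omega
      simp only [Y]
      nlinarith
    have heq : ∀ p ∈ EqualitySet m x, Y p.1 + Y p.2 = Y (p.1 + p.2) := fun p hp => by
      have hX : X p.1 + X p.2 = X (p.1 + p.2) := Subtype.ext hp.2.2.2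
      simp only [Y, ← hX, ← hzE p hp, map_add]
      ring
    refine ⟨fun c => Y c, ⟨fun i j hi hj hij => ?_, fun i _ => ⟨Y i, rfl, by simp [Y, hz]⟩⟩, ?_⟩
    · beta_reduce
      rcases (hx i j hi hj hij).lt_or_eq with h' | h'
      · exact_mod_cast (hlt i j h').le
      · exact_mod_cast (heq (i, j) ⟨hi, hj, hij, h'.symm⟩).ge
    · ext p
      refine ⟨fun ⟨h1, h2, h3, h4⟩ => ⟨h1, h2, h3, ?_⟩, fun hp => ⟨hp.1, hp.2.1, hp.2.2.1, ?_⟩⟩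
      · by_contra hne
        have := hlt _ _ (lt_of_le_of_ne (hx _ _ h1 h2 h3) (Ne.symm hne))
        exact this.ne' (by beta_reduce at h4; exact_mod_cast h4)
      · beta_reduce
        exact_mod_cast heq p hp
end

section
/- Fix a saturated subgroup L ⊆ ℤ^n, a vector γ ∈ ℤ^n, and an integer m ≥ 2. Then there exists v ∈ L with v_i ≡ γ_i (mod m) for each i = 1, …, n if and only if w · γ ≡ 0 (mod m) for every w ∈ L^⊥. -/
open scoped BigOperators

/-- The quotient of a `ℤ`-module by a saturated submodule is torsion-free. -/
theorem Submodule.isTorsionFree_quotient_of_saturated {M : Type*} [AddCommGroup M]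
    (N : Submodule ℤ M) (hN : ∀ k : ℤ, k ≠ 0 → ∀ v : M, k • v ∈ N → v ∈ N) :
    Module.IsTorsionFree ℤ (M ⧸ N) := by
  refine Module.IsTorsionFree.of_smul_eq_zero fun k x hx => ?_
  obtain ⟨v, rfl⟩ := N.mkQ_surjective x
  rw [← map_smul, N.mkQ_apply, Submodule.Quotient.mk_eq_zero] at hx
  refine or_iff_not_imp_left.2 fun hk => ?_
  rw [N.mkQ_apply, Submodule.Quotient.mk_eq_zero]
  exact hN k hk v hx

/-- In a finite free module over a commutative ring, an element on which every linear functional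
takes values divisible by `a` is itself a multiple of `a`. -/
theorem Module.exists_eq_smul_of_forall_dual_dvd {R M : Type*} [CommRing R] [AddCommGroup M]
    [Module R M] [Module.Free R M] [Module.Finite R M] (a : R) (x : M)
    (h : ∀ f : M →ₗ[R] R, a ∣ f x) : ∃ y : M, x = a • y := by
  let b := Module.Free.chooseBasis R M
  choose c hc using fun j => h (b.coord j)
  refine ⟨∑ j, c j • b j, ?_⟩
  rw [Finset.smul_sum, ← b.sum_repr x]
  refine Finset.sum_congr rfl fun j _ => ?_
  rw [smul_smul, ← hc j, b.coord_apply]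

/-- For a saturated subgroup `L ⊆ ℤ^n`, `γ ∈ ℤ^n`, and `m ≥ 2`: there exists `v ∈ L`
with `v ≡ γ (mod m)` coordinatewise iff `w · γ ≡ 0 (mod m)` for every `w ∈ L^⊥`. -/
theorem saturated_lattice_congruence_iff (n : ℕ) (L : AddSubgroup (Fin n → ℤ))
    (hsat : ∀ k : ℤ, k ≠ 0 → ∀ v : Fin n → ℤ, k • v ∈ L → v ∈ L)
    (γ : Fin n → ℤ) (m : ℕ) (hm : 2 ≤ m) :
    (∃ v ∈ L, ∀ i : Fin n, ((v i : ZMod m) = (γ i : ZMod m))) ↔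
      ∀ w : Fin n → ℤ, (∀ v ∈ L, ∑ i, w i * v i = 0) →
        ((∑ i, w i * γ i : ℤ) : ZMod m) = 0 := by
  constructor
  · rintro ⟨v, hv, hvγ⟩ w hw
    have h := congrArg (Int.cast : ℤ → ZMod m) (hw v hv)
    push_cast at h ⊢
    simpa only [hvγ] using h
  · intro h
    let N : Submodule ℤ (Fin n → ℤ) := AddSubgroup.toIntSubmodule L
    have : Module.IsTorsionFree ℤ ((Fin n → ℤ) ⧸ N) :=
      N.isTorsionFree_quotient_of_saturated hsat
    have hdvd : ∀ f : ((Fin n → ℤ) ⧸ N) →ₗ[ℤ] ℤ, (m : ℤ) ∣ f (N.mkQ γ) := by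
      intro f
      let w : Fin n → ℤ := fun i => f (N.mkQ fun j => if i = j then 1 else 0)
      have hf : ∀ v, f (N.mkQ v) = ∑ i, w i * v i := fun v => by
        simpa only [w, smul_eq_mul, mul_comm, LinearMap.comp_apply] using
          LinearMap.pi_apply_eq_sum_univ (f ∘ₗ N.mkQ) v
      rw [hf γ, ← ZMod.intCast_zmod_eq_zero_iff_dvd]
      refine h w fun v hv => ?_
      rw [← hf v, N.mkQ_apply, (Submodule.Quotient.mk_eq_zero N).2 hv, map_zero]
    obtain ⟨q, hq⟩ := Module.exists_eq_smul_of_forall_dual_dvd (m : ℤ) (N.mkQ γ) hdvd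
    obtain ⟨u, rfl⟩ := N.mkQ_surjective q
    refine ⟨γ - (m : ℤ) • u, ?_, fun i => by simp⟩
    rw [← map_smul] at hq
    exact (Submodule.Quotient.eq N).1 hq
end

section
/- Fix an integer m ≥ 2 and a point x ∈ C_m, and let F = {y ∈ C_m : y_i + y_j = y_{i+j} for all (i, j) ∈ E(x)} be the face of C_m whose relative interior contains x. If there exists an integer vector v ∈ ℤ^{m−1} lying in the ℝ-linear span of F such that v_c ≡ c (mod m) for every nonzero residue c, then there exists an Apéry point y of C_m with E(y) = E(x). -/
open scoped BigOperators

/-- Simultaneous Diophantine approximation: multiples of a finite family of reals come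
uniformly close to integers, for arbitrarily large multipliers. -/
theorem frequently_forall_abs_nsmul_sub_round_lt {ι : Type*} [Finite ι] (x : ι → ℝ) {ε : ℝ}
    (hε : 0 < ε) :
    ∃ᶠ n : ℕ in Filter.atTop, ∀ i, |(n : ℝ) * x i - round ((n : ℝ) * x i)| < ε := by
  have := Fintype.ofFinite ι
  have h := mapClusterPt_zero_atTop_nsmul (fun i => (x i : UnitAddCircle))
  refine (h.frequently (Metric.ball_mem_nhds _ hε)).mono fun n hn i => ?_
  rw [dist_zero_right, pi_norm_lt_iff hε] at hn
  have hi := hn i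
  rw [Pi.smul_apply, ← AddCircle.coe_nsmul, UnitAddCircle.norm_eq, nsmul_eq_mul] at hi
  exact hi

/-- A real vector indexed by a finite additive magma can be replaced by an integer vector with
the same additive equalities and strict subadditivity inequalities. -/
theorem exists_int_add_eq_and_add_lt {ι : Type*} [Finite ι] [Add ι] (x : ι → ℝ) :
    ∃ p : ι → ℤ, ∀ i j, (x i + x j = x (i + j) → p i + p j = p (i + j)) ∧
      (x (i + j) < x i + x j → p (i + j) < p i + p j) := by
  have hlarge : ∀ᶠ n : ℕ in Filter.atTop, ∀ i j, x (i + j) < x i + x j →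
      1 < (n : ℝ) * (x i + x j - x (i + j)) := by
    refine Filter.eventually_all.2 fun i => Filter.eventually_all.2 fun j => ?_
    by_cases hij : x (i + j) < x i + x j
    · filter_upwards [(tendsto_natCast_atTop_atTop.atTop_mul_const
        (sub_pos.2 hij)).eventually_gt_atTop 1] with n hn _ using hn
    · exact .of_forall fun _ h => absurd h hij
  obtain ⟨n, hround, hn⟩ := ((frequently_forall_abs_nsmul_sub_round_lt x
    (show (0 : ℝ) < 1 / 3 by norm_num)).and_eventually hlarge).exists
  refine ⟨fun i => round ((n : ℝ) * x i), fun i j => ?_⟩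
  have hi := abs_lt.1 (hround i)
  have hj := abs_lt.1 (hround j)
  have hij := abs_lt.1 (hround (i + j))
  refine ⟨fun h => ?_, fun h => ?_⟩
  · have hmul : (n : ℝ) * x i + n * x j = n * x (i + j) := by rw [← mul_add, h]
    refine sub_eq_zero.1 (Int.abs_lt_one_iff.1 ?_)
    rw [abs_lt]
    constructor <;> rify <;> linarith
  · have hgap := hn i j h
    rw [mul_sub, mul_add] at hgap
    rify
    linarith

/-- If the ℝ-linear span of the face of `C_m` whose relative interior contains `x` contains
an integer vector `v` with `v c ≡ c (mod m)` for every nonzero residue `c`, then there is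
an Apéry point of `C_m` with the same equality set as `x`. -/
theorem apery_point_of_apery_vector_in_span (m : ℕ) (hm : 2 ≤ m)
    (x : ZMod m → ℝ) (hx : x ∈ KunzCone m) (v : ZMod m → ℤ)
    (hv : (fun c => (v c : ℝ)) ∈ Submodule.span ℝ
      {y : ZMod m → ℝ | y ∈ KunzCone m ∧
        ∀ p ∈ EqualitySet m x, y p.1 + y p.2 = y (p.1 + p.2)})
    (hcong : ∀ c : ZMod m, c ≠ 0 → ((v c : ZMod m) = c)) :
    ∃ y, IsAperyPoint m y ∧ EqualitySet m y = EqualitySet m x := by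
  have : NeZero m := ⟨by omega⟩
  have hveq : ∀ p ∈ EqualitySet m x, v p.1 + v p.2 = v (p.1 + p.2) := by
    intro p hp
    have h : (v p.1 : ℝ) + v p.2 = v (p.1 + p.2) := by
      refine Submodule.span_induction
        (p := fun (y : ZMod m → ℝ) _ => y p.1 + y p.2 = y (p.1 + p.2))
        (fun y hy => hy.2 p hp) (by simp) (fun y z _ _ hy hz => ?_) (fun a y _ hy => ?_) hv
      · simp only [Pi.add_apply]
        linarith
      · simp only [Pi.smul_apply, smul_eq_mul, ← hy, mul_add]
    exact_mod_cast h
  obtain ⟨w, hw⟩ := exists_int_add_eq_and_add_lt x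
  set S : ℤ := ∑ c, |v c|
  have hvS : ∀ c, |v c| ≤ S := fun c =>
    Finset.single_le_sum (fun c _ => abs_nonneg (v c)) (Finset.mem_univ c)
  set y : ZMod m → ℤ := fun c => v c + m * ((3 * S + 1) * w c) with hy
  have hyeq : ∀ p ∈ EqualitySet m x, y p.1 + y p.2 = y (p.1 + p.2) := by
    intro p hp
    have hw' := (hw p.1 p.2).1 hp.2.2.2
    simp only [hy, ← hveq p hp, ← hw']
    ring
  have hylt : ∀ i j, x (i + j) < x i + x j → y (i + j) < y i + y j := by
    intro i j h
    have hw' := (hw i j).2 h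
    have hi := abs_le.1 (hvS i)
    have hj := abs_le.1 (hvS j)
    have hij := abs_le.1 (hvS (i + j))
    have hbound : 3 * S + 1 ≤ m * ((3 * S + 1) * (w i + w j - w (i + j))) := by
      have h₁ : 3 * S + 1 ≤ (3 * S + 1) * (w i + w j - w (i + j)) :=
        le_mul_of_one_le_right (by linarith) (by linarith)
      exact h₁.trans (le_mul_of_one_le_left (by linarith) (by exact_mod_cast (by omega : 1 ≤ m)))
    simp only [hy]
    linarith
  refine ⟨fun c => (y c : ℝ), ⟨fun i j hi hj hij => ?_, fun i hi => ⟨y i, rfl, ?_⟩⟩, ?_⟩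
  · have hcast : (y (i + j) : ℝ) ≤ y i + y j ↔ y (i + j) ≤ y i + y j := by norm_cast
    rcases (hx i j hi hj hij).eq_or_lt with h | h
    · exact hcast.2 (hyeq (i, j) ⟨hi, hj, hij, h.symm⟩).ge
    · exact hcast.2 (hylt i j h).le
  · simp [hy, hcong i hi]
  · ext ⟨i, j⟩
    have hcast : (y i + y j : ℝ) = y (i + j) ↔ y i + y j = y (i + j) := by norm_cast
    refine ⟨fun ⟨hi, hj, hij, h⟩ => ⟨hi, hj, hij, ?_⟩, fun hp => ?_⟩
    · by_contra hne
      have hlt := hylt i j ((hx i j hi hj hij).lt_of_ne (Ne.symm hne))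
      exact hlt.ne' (hcast.1 h)
    · exact ⟨hp.1, hp.2.1, hp.2.2.1, hcast.2 (hyeq (i, j) hp)⟩
end

section
/- Let N be a commutative additive monoid containing an absorbing element ∞ (meaning a + ∞ = ∞ for all a ∈ N), let n_1, …, n_k ∈ N, and let φ : ℕ^k → N be the monoid homomorphism φ(z) = z_1 n_1 + ⋯ + z_k n_k. If ρ and ρ′ are two presentations with respect to φ, then the subgroup of ℤ^k generated by {z − z′ : (z, z′) ∈ ρ} equals the subgroup of ℤ^k generated by {z − z′ : (z, z′) ∈ ρ′}. -/
open scoped BigOperators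

/-- An absorbing (nil) element of a commutative additive monoid. -/
def IsAbsorbing {N : Type*} [AddCommMonoid N] (inf : N) : Prop :=
  ∀ a : N, a + inf = inf

/-- The factorization homomorphism `φ(z) = z₁ n₁ + ⋯ + z_k n_k`. -/
def factMap {N : Type*} [AddCommMonoid N] {k : ℕ} (gens : Fin k → N)
    (z : Fin k → ℕ) : N :=
  ∑ i, z i • gens i

/-- A presentation of the semigroup generated by `gens` with nil element `inf`: a set of
pairs `(z, z')` of factorizations of common non-nil elements such that the congruence
generated by `ρ` together with all pairs of factorizations of `inf` is the kernel
congruence of `φ`. -/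
def IsPresentation {N : Type*} [AddCommMonoid N] {k : ℕ} (gens : Fin k → N)
    (inf : N) (ρ : Set ((Fin k → ℕ) × (Fin k → ℕ))) : Prop :=
  (∀ p ∈ ρ, factMap gens p.1 = factMap gens p.2 ∧ factMap gens p.1 ≠ inf) ∧
  ∀ z z' : Fin k → ℕ,
    (addConGen fun w w' : Fin k → ℕ =>
        (w, w') ∈ ρ ∨ (factMap gens w = inf ∧ factMap gens w' = inf)) z z' ↔
      factMap gens z = factMap gens z'

theorem factMap_add {N : Type*} [AddCommMonoid N] {k : ℕ} (gens : Fin k → N)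
    (z w : Fin k → ℕ) : factMap gens (z + w) = factMap gens z + factMap gens w := by
  simp [factMap, add_smul, Finset.sum_add_distrib]

/-- Two factorizations of the same non-nil element differ by an element of the lattice spanned
by the differences of any presentation. -/
theorem IsPresentation.sub_mem_closure {N : Type*} [AddCommMonoid N] {k : ℕ}
    {gens : Fin k → N} {inf : N} (habs : IsAbsorbing inf)
    {ρ : Set ((Fin k → ℕ) × (Fin k → ℕ))} (h : IsPresentation gens inf ρ)
    {z z' : Fin k → ℕ} (hz : factMap gens z = factMap gens z') (hne : factMap gens z ≠ inf) :
    (fun i => (z i : ℤ) - (z' i : ℤ)) ∈ AddSubgroup.closure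
      {v : Fin k → ℤ | ∃ p ∈ ρ, v = fun i => (p.1 i : ℤ) - (p.2 i : ℤ)} := by
  set L := AddSubgroup.closure
    {v : Fin k → ℤ | ∃ p ∈ ρ, v = fun i => (p.1 i : ℤ) - (p.2 i : ℤ)}
  let c : AddCon (Fin k → ℕ) :=
    { r := fun w w' => factMap gens w = factMap gens w' ∧
        (factMap gens w ≠ inf → (fun i => (w i : ℤ) - (w' i : ℤ)) ∈ L)
      iseqv :=
        { refl := fun w => ⟨rfl, fun _ => by
            simp only [sub_self]
            exact L.zero_mem⟩
          symm := fun {w w'} hw => ⟨hw.1.symm, fun hne => by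
            convert L.neg_mem (hw.2 (hw.1 ▸ hne)) using 1
            ext i
            simp⟩
          trans := fun {u v w} huv hvw => ⟨huv.1.trans hvw.1, fun hne => by
            convert L.add_mem (huv.2 hne) (hvw.2 (huv.1 ▸ hne)) using 1
            ext i
            simp⟩ }
      add' := fun {u v w x} huv hwx => by
        refine ⟨by rw [factMap_add, factMap_add, huv.1, hwx.1], fun hne => ?_⟩
        rw [factMap_add] at hne
        have hu : factMap gens u ≠ inf := fun e => hne (by rw [e, add_comm, habs])
        have hw : factMap gens w ≠ inf := fun e => hne (by rw [e, habs])
        convert L.add_mem (huv.2 hu) (hwx.2 hw) using 1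
        ext i
        simp only [Pi.add_apply, Nat.cast_add]
        ring }
  have hle : (addConGen fun w w' : Fin k → ℕ =>
      (w, w') ∈ ρ ∨ (factMap gens w = inf ∧ factMap gens w' = inf)) ≤ c := by
    refine AddCon.addConGen_le.2 fun w w' hw => ?_
    rcases hw with hw | ⟨hw, hw'⟩
    · exact ⟨(h.1 _ hw).1, fun _ => AddSubgroup.subset_closure ⟨_, hw, rfl⟩⟩
    · exact ⟨hw.trans hw'.symm, fun hne => absurd hw hne⟩
  exact (hle ((h.2 z z').2 hz)).2 hne

theorem IsPresentation.closure_le {N : Type*} [AddCommMonoid N] {k : ℕ}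
    {gens : Fin k → N} {inf : N} (habs : IsAbsorbing inf)
    {ρ ρ' : Set ((Fin k → ℕ) × (Fin k → ℕ))}
    (h : IsPresentation gens inf ρ) (h' : IsPresentation gens inf ρ') :
    AddSubgroup.closure
        {v : Fin k → ℤ | ∃ p ∈ ρ, v = fun i => (p.1 i : ℤ) - (p.2 i : ℤ)} ≤
      AddSubgroup.closure
        {v : Fin k → ℤ | ∃ p ∈ ρ', v = fun i => (p.1 i : ℤ) - (p.2 i : ℤ)} := by
  rw [AddSubgroup.closure_le]
  rintro _ ⟨p, hp, rfl⟩
  exact h'.sub_mem_closure habs (h.1 p hp).1 (h.1 p hp).2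

/-- Any two presentations of a commutative monoid with a nil element generate the same
subgroup of `ℤ^k` (the presentation lattice is independent of the presentation). -/
theorem presentation_lattice_independent {N : Type*} [AddCommMonoid N] (k : ℕ)
    (gens : Fin k → N) (inf : N) (habs : IsAbsorbing inf)
    (ρ ρ' : Set ((Fin k → ℕ) × (Fin k → ℕ)))
    (h : IsPresentation gens inf ρ) (h' : IsPresentation gens inf ρ') :
    AddSubgroup.closure
        {v : Fin k → ℤ | ∃ p ∈ ρ, v = fun i => (p.1 i : ℤ) - (p.2 i : ℤ)} =
      AddSubgroup.closure
        {v : Fin k → ℤ | ∃ p ∈ ρ', v = fun i => (p.1 i : ℤ) - (p.2 i : ℤ)} := by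
  exact le_antisymm (h.closure_le habs h') (h'.closure_le habs h)
end

section
/- Fix an integer m ≥ 3 and nonzero residues i₀, j₀ ∈ ℤ/mℤ with i₀ + j₀ ≠ 0. Then there exists an Apéry point y of C_m whose equality set E(y) is exactly {(i₀, j₀), (j₀, i₀)} (which is the singleton {(i₀, i₀)} when i₀ = j₀). In other words, every facet of C_m is Apéry, i.e., contains an Apéry point in its relative interior. -/
open scoped BigOperators

open Classical in
/-- An integer point in the relative interior of the facet of `(i, j)`, chosen with
`facetPoint i j a ≡ a (mod m)`. -/
noncomputable def facetPoint {m : ℕ} (i j a : ZMod m) : ℤ :=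
  if a = i ∨ a = j then a.val + 6 * m
  else if a = i + j then i.val + j.val + 12 * m
  else a.val + 9 * m

theorem intCast_facetPoint {m : ℕ} [NeZero m] (i j a : ZMod m) :
    (facetPoint i j a : ZMod m) = a := by
  unfold facetPoint
  split_ifs with h h' <;> simp [*]

theorem facetPoint_add_eq {m : ℕ} {i j : ZMod m} (hi : i ≠ 0) (hj : j ≠ 0) :
    facetPoint i j i + facetPoint i j j = facetPoint i j (i + j) := by
  simp [facetPoint, hi, hj]
  ring

theorem facetPoint_add_lt {m : ℕ} [NeZero m] {i j a b : ZMod m}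
    (h₁ : ¬(a = i ∧ b = j)) (h₂ : ¬(a = j ∧ b = i)) :
    facetPoint i j (a + b) < facetPoint i j a + facetPoint i j b := by
  have hlt (c : ZMod m) : (c.val : ℤ) < m := by exact_mod_cast c.val_lt
  have hlower (c : ZMod m) : 6 * (m : ℤ) ≤ facetPoint i j c := by
    unfold facetPoint
    split_ifs <;> omega
  have hlower' (c : ZMod m) (hc : ¬(c = i ∨ c = j)) : 9 * (m : ℤ) ≤ facetPoint i j c := by
    unfold facetPoint
    split_ifs <;> omega
  have hupper (c : ZMod m) : facetPoint i j c < 14 * m := by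
    have := hlt i
    have := hlt j
    have := hlt c
    unfold facetPoint
    split_ifs <;> omega
  have hupper' (c : ZMod m) (hc : c ≠ i + j) : facetPoint i j c < 10 * m := by
    have := hlt c
    unfold facetPoint
    split_ifs <;> omega
  have ha := hlower a
  have hb := hlower b
  by_cases hc : a + b = i + j
  · have hc' := hupper (a + b)
    by_cases ha' : a = i ∨ a = j
    · by_cases hb' : b = i ∨ b = j
      · rcases ha' with rfl | rfl
        · exact absurd ⟨rfl, add_left_cancel hc⟩ h₁
        · exact absurd ⟨rfl, add_left_cancel (hc.trans (add_comm _ _))⟩ h₂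
      · have := hlower' b hb'
        omega
    · have := hlower' a ha'
      omega
  · have := hupper' _ hc
    omega

/-- Every facet of the Kunz cone is Apéry: for nonzero residues `i₀, j₀` with
`i₀ + j₀ ≠ 0` there is an Apéry point whose equality set is exactly
`{(i₀, j₀), (j₀, i₀)}`. -/
theorem facet_is_apery (m : ℕ) (hm : 3 ≤ m) (i₀ j₀ : ZMod m)
    (hi : i₀ ≠ 0) (hj : j₀ ≠ 0) (hij : i₀ + j₀ ≠ 0) :
    ∃ y, IsAperyPoint m y ∧ EqualitySet m y = {(i₀, j₀), (j₀, i₀)} := by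
  have : NeZero m := ⟨by omega⟩
  have heq := facetPoint_add_eq hi hj
  refine ⟨fun a => facetPoint i₀ j₀ a, ⟨?_, fun a _ => ⟨_, rfl, intCast_facetPoint _ _ _⟩⟩, ?_⟩
  · intro a b _ _ _
    dsimp only
    norm_cast
    by_cases h₁ : a = i₀ ∧ b = j₀
    · rw [h₁.1, h₁.2, heq]
    by_cases h₂ : a = j₀ ∧ b = i₀
    · rw [h₂.1, h₂.2, add_comm j₀, ← heq, add_comm]
    exact (facetPoint_add_lt h₁ h₂).le
  · ext ⟨a, b⟩
    simp only [EqualitySet, Set.mem_ofPred_eq, Set.mem_insert_iff, Set.mem_singleton_iff,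
      Prod.mk.injEq]
    norm_cast
    constructor
    · rintro ⟨_, _, _, h⟩
      by_contra! hne
      exact (facetPoint_add_lt (fun h' => hne.1 h'.1 h'.2) (fun h' => hne.2 h'.1 h'.2)).ne' h
    · rintro (⟨rfl, rfl⟩ | ⟨rfl, rfl⟩)
      · exact ⟨hi, hj, hij, heq⟩
      · exact ⟨hj, hi, add_comm b a ▸ hij, by rw [add_comm, heq, add_comm b]⟩
end

section
/- Fix an integer m ≥ 2 and a point x ∈ C_m all of whose coordinates are positive. Then d(x) ≥ e(x) − Σ_a (|Z(a)| − 1), where the sum runs over all nonzero residues a ∈ ℤ/mℤ. -/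
open scoped BigOperators

theorem kunzFactorizations_finite {m : ℕ} [NeZero m] {x : ZMod m → ℝ}
    (hpos : ∀ i : ZMod m, i ≠ 0 → 0 < x i) (a : ZMod m) :
    (KunzFactorizations m x a).Finite := by
  refine (Set.finite_Icc (0 : ZMod m → ℕ) (fun c => ⌈x a / x c⌉₊)).subset ?_
  rintro z ⟨hA, -, hz⟩
  refine ⟨fun c => Nat.zero_le _, fun c => ?_⟩
  have hnonneg : ∀ d ∈ Finset.univ, 0 ≤ (z d : ℝ) * x d := by
    intro d _
    by_cases hd : z d = 0
    · simp [hd]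
    · exact mul_nonneg (Nat.cast_nonneg _) (hpos d (hA d hd).1).le
  by_cases hc : z c = 0
  · simp [hc]
  · have hle := Finset.single_le_sum hnonneg (Finset.mem_univ c)
    rw [hz, ← le_div_iff₀ (hpos c (hA c hc).1)] at hle
    exact_mod_cast hle.trans (Nat.le_ceil _)

theorem KunzAtoms.single_mem_kunzFactorizations {m : ℕ} [NeZero m] {x : ZMod m → ℝ}
    {a : ZMod m} (ha : a ∈ KunzAtoms m x) :
    (Pi.single a 1 : ZMod m → ℕ) ∈ KunzFactorizations m x a := by
  refine ⟨fun c hc => ?_, ?_, ?_⟩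
  · by_cases h : c = a
    · exact h ▸ ha
    · exact absurd (Pi.single_eq_of_ne h 1) hc
  · rw [Finset.sum_eq_single a] <;> simp +contextual
  · rw [Finset.sum_eq_single a] <;> simp +contextual

theorem add_mem_kunzFactorizations {m : ℕ} [NeZero m] {x : ZMod m → ℝ} {i j : ZMod m}
    (hij : x i + x j = x (i + j)) {z w : ZMod m → ℕ}
    (hz : z ∈ KunzFactorizations m x i) (hw : w ∈ KunzFactorizations m x j) :
    z + w ∈ KunzFactorizations m x (i + j) := by
  obtain ⟨hzA, hzs, hzx⟩ := hz
  obtain ⟨hwA, hws, hwx⟩ := hw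
  refine ⟨fun c hc => ?_, ?_, ?_⟩
  · by_cases h : z c = 0
    · exact hwA c fun h' => hc (by simp [h, h'])
    · exact hzA c h
  · simp only [Pi.add_apply, Nat.cast_add, add_mul, Finset.sum_add_distrib, hzs, hws]
  · simp only [Pi.add_apply, Nat.cast_add, add_mul, Finset.sum_add_distrib, hzx, hwx, hij]

theorem kunzFactorizations_nonempty {m : ℕ} [NeZero m] {x : ZMod m → ℝ}
    (hpos : ∀ i : ZMod m, i ≠ 0 → 0 < x i) (a : ZMod m) (ha : a ≠ 0) :
    (KunzFactorizations m x a).Nonempty := by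
  have hwf : WellFounded (InvImage (· < ·) x) := by
    have : IsTrans (ZMod m) (InvImage (· < ·) x) := ⟨fun _ _ _ => lt_trans (α := ℝ)⟩
    have : Std.Irrefl (InvImage (· < ·) x) := ⟨fun _ => lt_irrefl (α := ℝ) _⟩
    exact Finite.wellFounded_of_trans_of_irrefl _
  induction a using hwf.induction with
  | _ a ih =>
    by_cases hA : a ∈ KunzAtoms m x
    · exact ⟨_, KunzAtoms.single_mem_kunzFactorizations hA⟩
    · obtain ⟨i, j, hi, hj, rfl, hij⟩ : ∃ i j : ZMod m, i ≠ 0 ∧ j ≠ 0 ∧ i + j = a ∧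
          x i + x j = x a := by
        by_contra! h
        exact hA ⟨ha, h⟩
      obtain ⟨z, hz⟩ := ih i (show x i < x (i + j) by linarith [hpos j hj]) hi
      obtain ⟨w, hw⟩ := ih j (show x j < x (i + j) by linarith [hpos i hi]) hj
      exact ⟨z + w, add_mem_kunzFactorizations hij hz hw⟩

/-- The rank of the equality set is at most the number of nonzero non-atoms plus the total
excess of the factorization counts. -/
theorem finrank_span_hypVec_le {m : ℕ} [NeZero m] {x : ZMod m → ℝ}
    (hpos : ∀ i : ZMod m, i ≠ 0 → 0 < x i) :
    Module.finrank ℚ (Submodule.span ℚ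
        {v : ZMod m → ℚ | ∃ p ∈ EqualitySet m x, v = hypVec m p.1 p.2}) ≤
      (m - 1 - kunzE m x) +
        ∑ a ∈ Finset.univ.erase (0 : ZMod m), ((KunzFactorizations m x a).ncard - 1) := by
  classical
  have hex : ∀ a : ZMod m, ∃ z : ZMod m → ℕ, (a ≠ 0 → z ∈ KunzFactorizations m x a) ∧
      (a ∈ KunzAtoms m x → z = Pi.single a 1) := by
    intro a
    by_cases hA : a ∈ KunzAtoms m x
    · exact ⟨_, fun _ => KunzAtoms.single_mem_kunzFactorizations hA, fun _ => rfl⟩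
    · by_cases ha : a = 0
      · exact ⟨0, fun h => absurd ha h, fun h => absurd h hA⟩
      · obtain ⟨z, hz⟩ := kunzFactorizations_nonempty hpos a ha
        exact ⟨z, fun _ => hz, fun h => absurd h hA⟩
  choose f hf hfA using hex
  let q : (ZMod m → ℕ) → ZMod m → ℚ := fun z c => (z c : ℚ)
  let R : Finset (ZMod m → ℚ) :=
    (Finset.univ.erase 0 \ (KunzAtoms m x).toFinset).image fun a => Pi.single a 1 - q (f a)
  let D : ZMod m → Finset (ZMod m → ℚ) := fun a =>
    ((kunzFactorizations_finite hpos a).toFinset.erase (f a)).image fun z => q z - q (f a)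
  let T := R ∪ (Finset.univ.erase 0).biUnion D
  have hR : R.card ≤ m - 1 - kunzE m x := by
    refine Finset.card_image_le.trans ?_
    rw [Finset.card_sdiff_of_subset, Finset.card_erase_of_mem (Finset.mem_univ _),
      Finset.card_univ, ZMod.card, kunzE, Set.ncard_eq_toFinset_card']
    intro a ha
    simpa using (Set.mem_toFinset.1 ha).1
  have hD : ∀ a ∈ Finset.univ.erase (0 : ZMod m),
      (D a).card ≤ (KunzFactorizations m x a).ncard - 1 := by
    intro a ha
    refine Finset.card_image_le.trans ?_
    rw [Finset.card_erase_of_mem, Set.ncard_eq_toFinset_card _ (kunzFactorizations_finite hpos a)]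
    simpa using hf a (Finset.ne_of_mem_erase ha)
  have hsingle : ∀ a : ZMod m, a ≠ 0 →
      (Pi.single a 1 - q (f a) : ZMod m → ℚ) ∈ Submodule.span ℚ (T : Set (ZMod m → ℚ)) := by
    intro a ha
    by_cases hA : a ∈ KunzAtoms m x
    · have : (Pi.single a 1 : ZMod m → ℚ) = q (f a) := by
        ext c
        simp only [q, hfA a hA, Pi.single_apply]
        split_ifs <;> simp
      rw [this, sub_self]
      exact zero_mem _
    · refine Submodule.subset_span (Finset.mem_coe.2 (Finset.mem_union_left _ ?_))
      exact Finset.mem_image_of_mem _ (by simp [ha, hA])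
  have hdiff : ∀ a : ZMod m, a ≠ 0 → ∀ z ∈ KunzFactorizations m x a,
      q z - q (f a) ∈ Submodule.span ℚ (T : Set (ZMod m → ℚ)) := by
    intro a ha z hz
    by_cases h : z = f a
    · rw [h, sub_self]
      exact zero_mem _
    · refine Submodule.subset_span (Finset.mem_coe.2 (Finset.mem_union_right _ ?_))
      exact Finset.mem_biUnion.2 ⟨a, by simp [ha], Finset.mem_image_of_mem _ (by simp [h, hz])⟩
  have hspan : Submodule.span ℚ
      {v : ZMod m → ℚ | ∃ p ∈ EqualitySet m x, v = hypVec m p.1 p.2} ≤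
      Submodule.span ℚ (T : Set (ZMod m → ℚ)) := by
    rw [Submodule.span_le]
    rintro v ⟨⟨i, j⟩, ⟨hi, hj, hij, he⟩, rfl⟩
    have hadd : q (f i + f j) = q (f i) + q (f j) := by
      ext c
      simp [q]
    have hdecomp : hypVec m i j = (Pi.single i 1 - q (f i)) + (Pi.single j 1 - q (f j)) -
        (Pi.single (i + j) 1 - q (f (i + j))) + (q (f i + f j) - q (f (i + j))) := by
      rw [hadd, hypVec]
      abel
    change hypVec m i j ∈ _
    rw [hdecomp]
    exact add_mem (sub_mem (add_mem (hsingle i hi) (hsingle j hj)) (hsingle _ hij))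
      (hdiff _ hij _ (add_mem_kunzFactorizations he (hf i hi) (hf j hj)))
  calc _ ≤ Module.finrank ℚ (Submodule.span ℚ (T : Set (ZMod m → ℚ))) :=
        Submodule.finrank_mono hspan
    _ ≤ T.card := finrank_span_finset_le_card T
    _ ≤ R.card + ((Finset.univ.erase 0).biUnion D).card := Finset.card_union_le _ _
    _ ≤ _ := add_le_add hR (Finset.card_biUnion_le.trans (Finset.sum_le_sum hD))

/-- `d(x) ≥ e(x) - Σ_a (|Z(a)| - 1)`, the sum over all nonzero residues `a`. -/
theorem dim_ge_embdim_sub_factorization_excess (m : ℕ) (hm : 2 ≤ m) [NeZero m]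
    (x : ZMod m → ℝ) (hx : x ∈ KunzCone m) (hpos : ∀ i : ZMod m, i ≠ 0 → 0 < x i) :
    (kunzE m x : ℤ) -
        ∑ a ∈ Finset.univ.erase (0 : ZMod m),
          (((KunzFactorizations m x a).ncard : ℤ) - 1) ≤
      (kunzD m x : ℤ) := by
  have hrank := finrank_span_hypVec_le hpos
  have hE : kunzE m x ≤ m - 1 := by
    have hsub : KunzAtoms m x ⊆ ↑(Finset.univ.erase (0 : ZMod m)) := fun a ha => by
      simpa using ha.1
    have := Set.ncard_le_ncard hsub
    rwa [Set.ncard_coe_finset, Finset.card_erase_of_mem (Finset.mem_univ _),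
      Finset.card_univ, ZMod.card] at this
  have hsum : ∑ a ∈ Finset.univ.erase (0 : ZMod m),
        (((KunzFactorizations m x a).ncard : ℤ) - 1) =
      ((∑ a ∈ Finset.univ.erase (0 : ZMod m),
        ((KunzFactorizations m x a).ncard - 1) : ℕ) : ℤ) := by
    rw [Nat.cast_sum]
    refine Finset.sum_congr rfl fun a ha => ?_
    have := (Set.ncard_pos (kunzFactorizations_finite hpos a)).2
      (kunzFactorizations_nonempty hpos a (Finset.ne_of_mem_erase ha))
    omega
  rw [hsum, kunzD]
  omega
end

section
/- Fix an integer m ≥ 2, a point x ∈ C_m all of whose coordinates are positive, and a nonzero residue p ∈ ℤ/mℤ; set e = e(x) and let A₂ = {z ∈ Z(p) : Σ_{c ∈ A(x)} z_c = 2} be the set of factorizations of p with coordinate sum 2. Then: (a) |A₂| ≤ ⌊e/2⌋ + 1; (b) if m is odd and e is even, then |A₂| ≤ e/2; and (c) if m is even and |A₂| = ⌊e/2⌋ + 1, then there exists a nonzero residue q with 2q = p in ℤ/mℤ and x_q + x_q = x_p. -/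
open scoped BigOperators

theorem exists_eq_single_add_of_sum_eq_succ {ι : Type*} [Fintype ι] [DecidableEq ι]
    {z : ι → ℕ} {n : ℕ} (h : ∑ c, z c = n + 1) :
    ∃ (a : ι) (w : ι → ℕ), z = Pi.single a 1 + w ∧ ∑ c, w c = n := by
  obtain ⟨a, -, ha⟩ : ∃ a ∈ Finset.univ, z a ≠ 0 :=
    Finset.exists_ne_zero_of_sum_ne_zero (by omega)
  have key : z = Pi.single a 1 + (z - Pi.single a 1 : ι → ℕ) := by
    ext c
    by_cases hc : c = a
    · subst hc
      simp only [Pi.add_apply, Pi.sub_apply, Pi.single_eq_same]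
      omega
    · simp [hc]
  refine ⟨a, z - Pi.single a 1, key, ?_⟩
  have h2 : ∑ c, z c = ∑ c, (Pi.single a 1 : ι → ℕ) c +
      ∑ c, (z - Pi.single a 1 : ι → ℕ) c := by
    rw [← Finset.sum_add_distrib]
    exact Finset.sum_congr rfl fun c _ => congrFun key c
  rw [Finset.sum_pi_single', if_pos (Finset.mem_univ a), h] at h2
  omega

/-- A tuple of natural numbers with coordinate sum `2` is a sum of two unit vectors. -/
theorem exists_eq_single_add_single_of_sum_eq_two {ι : Type*} [Fintype ι] [DecidableEq ι]
    {z : ι → ℕ} (h : ∑ c, z c = 2) :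
    ∃ a b, z = Pi.single a 1 + Pi.single b 1 := by
  obtain ⟨a, w, rfl, hw⟩ := exists_eq_single_add_of_sum_eq_succ h
  obtain ⟨b, v, rfl, hv⟩ := exists_eq_single_add_of_sum_eq_succ hw
  have hv0 : v = 0 := by
    ext c
    exact Finset.sum_eq_zero_iff.mp hv c (Finset.mem_univ c)
  exact ⟨a, b, by rw [hv0, add_zero]⟩

/-- A map identifying `a` with `p - a` on a set stable under `a ↦ p - a` has an image whose
size is controlled by the size of the set and the number of fixed points. -/
theorem two_mul_card_image_le_of_reflection {G β : Type*} [AddCommGroup G] [DecidableEq G]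
    [DecidableEq β] (p : G) (S : Finset G) (g : G → β) (hS : ∀ a ∈ S, p - a ∈ S)
    (hg : ∀ a, g (p - a) = g a) :
    2 * (S.image g).card ≤ S.card + (S.filter fun a => a + a = p).card := by
  have h1 : 2 * ((S.filter fun a => ¬ a + a = p).image g).card ≤
      (S.filter fun a => ¬ a + a = p).card := by
    apply Finset.mul_card_image_le_card
    intro b hb
    obtain ⟨a, ha, rfl⟩ := Finset.mem_image.mp hb
    obtain ⟨haS, hap⟩ := Finset.mem_filter.mp ha
    have hne : a ≠ p - a := fun h => hap (eq_sub_iff_add_eq.mp h)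
    rw [← Finset.card_pair hne]
    apply Finset.card_le_card
    intro c hc
    rcases Finset.mem_insert.mp hc with rfl | hc
    · simp [haS, hap]
    · rw [Finset.mem_singleton] at hc
      subst hc
      simp only [Finset.mem_filter, hg, and_true]
      refine ⟨hS a haS, fun h => hne ?_⟩
      rw [← sub_eq_zero]
      have h' : a - (p - a) = p - (p - a + (p - a)) := by abel
      rw [h', h, sub_self]
  have h2 : (S.image g).card ≤ ((S.filter fun a => a + a = p).image g).card +
      ((S.filter fun a => ¬ a + a = p).image g).card := by
    refine le_trans (Finset.card_le_card ?_) (Finset.card_union_le _ _)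
    rw [← Finset.image_union, Finset.filter_union_filter_not_eq]
  have h3 : ((S.filter fun a => a + a = p).image g).card ≤ _ := Finset.card_image_le
  have h4 := Finset.card_filter_add_card_filter_not (s := S) (fun a => a + a = p)
  omega

theorem ZMod.card_filter_add_self_eq_le_two (m : ℕ) [NeZero m] (p : ZMod m) :
    (Finset.univ.filter fun q : ZMod m => q + q = p).card ≤ 2 := by
  rcases (Finset.univ.filter fun q : ZMod m => q + q = p).eq_empty_or_nonempty with h | ⟨q₀, hq₀⟩
  · simp [h]
  · refine le_trans (Finset.card_le_card_of_injOn (fun q => q - q₀) ?_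
      (sub_left_injective.injOn)) (IsAddCyclic.card_nsmul_eq_zero_le (α := ZMod m) two_pos)
    intro q hq
    simp only [Finset.coe_filter, Finset.mem_univ, true_and, Set.mem_ofPred_eq,
      Finset.mem_filter] at hq hq₀ ⊢
    rw [two_nsmul, ← sub_self p]
    nth_rewrite 1 [← hq]
    rw [← hq₀]
    abel

theorem ZMod.card_filter_add_self_eq_le_one {m : ℕ} [NeZero m] (hm : Odd m) (p : ZMod m) :
    (Finset.univ.filter fun q : ZMod m => q + q = p).card ≤ 1 := by
  rw [Finset.card_le_one]
  intro a ha b hb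
  simp only [Finset.mem_univ, true_and, Finset.mem_filter] at ha hb
  have hu : IsUnit ((2 : ℕ) : ZMod m) :=
    (ZMod.isUnit_iff_coprime 2 m).mpr hm.coprime_two_left
  apply hu.mul_left_cancel
  push_cast
  rw [two_mul, two_mul, ha, hb]

open Classical in
/-- The atoms `a` such that `a + (p - a)` is a factorization of `p` into two atoms. -/
noncomputable def kunzHalves (m : ℕ) [NeZero m] (x : ZMod m → ℝ) (p : ZMod m) :
    Finset (ZMod m) :=
  Finset.univ.filter fun a =>
    a ∈ KunzAtoms m x ∧ p - a ∈ KunzAtoms m x ∧ x a + x (p - a) = x p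

theorem sumTwoFactorizations_subset_image (m : ℕ) [NeZero m] (x : ZMod m → ℝ) (p : ZMod m) :
    KunzFactorizations m x p ∩ {z | ∑ c : ZMod m, z c = 2} ⊆
      ((kunzHalves m x p).image
        fun a => (Pi.single a 1 + Pi.single (p - a) 1 : ZMod m → ℕ) : Finset (ZMod m → ℕ)) := by
  rintro z ⟨⟨hatoms, hres, hval⟩, hsum⟩
  obtain ⟨a, b, rfl⟩ := exists_eq_single_add_single_of_sum_eq_two hsum
  simp only [Pi.add_apply, Nat.cast_add, add_mul, Finset.sum_add_distrib, Pi.single_apply,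
    Nat.cast_ite, Nat.cast_one, Nat.cast_zero, ite_mul, one_mul, zero_mul, Finset.sum_ite_eq',
    Finset.mem_univ, if_true] at hres hval
  obtain rfl : b = p - a := eq_sub_of_add_eq' hres
  simp only [Finset.coe_image, Set.mem_image]
  refine ⟨a, ?_, rfl⟩
  simp only [kunzHalves, Finset.coe_filter, Finset.mem_univ, true_and, Set.mem_ofPred_eq]
  exact ⟨hatoms a (by simp), hatoms (p - a) (by simp), hval⟩

theorem two_mul_ncard_sumTwoFactorizations_le (m : ℕ) [NeZero m] (x : ZMod m → ℝ)
    (p : ZMod m) :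
    2 * (KunzFactorizations m x p ∩ {z | ∑ c : ZMod m, z c = 2}).ncard ≤
      kunzE m x + ((kunzHalves m x p).filter fun a => a + a = p).card := by
  have h1 := Set.ncard_le_ncard (sumTwoFactorizations_subset_image m x p)
    (Finset.finite_toSet _)
  rw [Set.ncard_coe_finset] at h1
  have h2 := two_mul_card_image_le_of_reflection p (kunzHalves m x p)
    (fun a => (Pi.single a 1 + Pi.single (p - a) 1 : ZMod m → ℕ))
    (by
      intro a ha
      simp only [kunzHalves, Finset.mem_filter, Finset.mem_univ, true_and, sub_sub_cancel] at ha ⊢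
      exact ⟨ha.2.1, ha.1, by rw [add_comm, ha.2.2]⟩)
    (by
      intro a
      simp only [sub_sub_cancel]
      exact add_comm _ _)
  have h3 : (kunzHalves m x p).card ≤ kunzE m x := by
    rw [kunzE, ← Set.ncard_coe_finset]
    apply Set.ncard_le_ncard _ (Set.toFinite _)
    intro a ha
    simp only [kunzHalves, Finset.coe_filter, Finset.mem_univ, true_and, Set.mem_ofPred_eq] at ha
    exact ha.1
  omega

/-- Bounds on the number of coordinate-sum-2 factorizations of a nonzero residue `p`:
(a) `|A₂| ≤ ⌊e/2⌋ + 1`; (b) if `m` is odd and `e` is even, `|A₂| ≤ e/2`; (c) if `m` is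
even and `|A₂| = ⌊e/2⌋ + 1`, then `p = 2q` for some nonzero residue `q` with
`x q + x q = x p`. -/
theorem coordinate_sum_two_factorization_bounds (m : ℕ) (hm : 2 ≤ m) [NeZero m]
    (x : ZMod m → ℝ) (hx : x ∈ KunzCone m) (hpos : ∀ i : ZMod m, i ≠ 0 → 0 < x i)
    (p : ZMod m) (hp : p ≠ 0) :
    (KunzFactorizations m x p ∩ {z | ∑ c : ZMod m, z c = 2}).ncard ≤ kunzE m x / 2 + 1 ∧
    (Odd m → Even (kunzE m x) →
      (KunzFactorizations m x p ∩ {z | ∑ c : ZMod m, z c = 2}).ncard ≤ kunzE m x / 2) ∧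
    (Even m →
      (KunzFactorizations m x p ∩ {z | ∑ c : ZMod m, z c = 2}).ncard = kunzE m x / 2 + 1 →
      ∃ q : ZMod m, q ≠ 0 ∧ q + q = p ∧ x q + x q = x p) := by
  have hkey := two_mul_ncard_sumTwoFactorizations_le m x p
  have hsub : ((kunzHalves m x p).filter fun a => a + a = p).card ≤
      (Finset.univ.filter fun q : ZMod m => q + q = p).card :=
    Finset.card_le_card (Finset.filter_subset_filter _ (Finset.subset_univ _))
  refine ⟨?_, fun hodd heven => ?_, fun _ hcard => ?_⟩
  · have := ZMod.card_filter_add_self_eq_le_two m p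
    omega
  · have := ZMod.card_filter_add_self_eq_le_one hodd p
    obtain ⟨k, hk⟩ := heven
    omega
  · obtain ⟨q, hq⟩ : ((kunzHalves m x p).filter fun a => a + a = p).Nonempty :=
      Finset.card_pos.mp (by omega)
    simp only [kunzHalves, Finset.mem_filter, Finset.mem_univ, true_and] at hq
    obtain ⟨⟨hqA, -, hqx⟩, hqp⟩ := hq
    refine ⟨q, hqA.1, hqp, ?_⟩
    rwa [← eq_sub_of_add_eq hqp] at hqx
end

section
/- Fix an integer m and a point x ∈ C_m all of whose coordinates are positive with e(x) = m − 3. If some nonzero residue a ∈ ℤ/mℤ has a factorization z ∈ Z(a) with coordinate sum Σ_{c ∈ A(x)} z_c = 3, then d(x) ≥ ⌊(m−3)/2⌋. -/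
open scoped BigOperators

/-- A function on a finite set that is invariant under an involution of the set takes at most
half as many values as the set has points, each fixed point being counted twice. -/
theorem two_mul_card_image_le_of_involution {α β : Type*} [DecidableEq α] [DecidableEq β]
    (S : Finset α) (τ : α → α) (f : α → β) (hτ : ∀ i ∈ S, τ i ∈ S)
    (hf : ∀ i ∈ S, f (τ i) = f i) :
    2 * (S.image f).card ≤ S.card + (S.filter fun i => τ i = i).card := by
  rw [Finset.card_eq_sum_card_image f S,
    Finset.card_eq_sum_card_fiberwise (f := f) (s := S.filter fun i => τ i = i)
      (t := S.image f)
      (fun i hi => Finset.mem_coe.2 (Finset.mem_image_of_mem f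
        (Finset.mem_filter.1 (Finset.mem_coe.1 hi)).1)),
    ← Finset.sum_add_distrib, mul_comm, ← smul_eq_mul]
  refine Finset.card_nsmul_le_sum _ _ _ fun b hb => ?_
  obtain ⟨i, hi, rfl⟩ := Finset.mem_image.1 hb
  have hmem : i ∈ S.filter fun j => f j = f i := by simp [hi]
  by_cases h : τ i = i
  · have h1 := Finset.card_pos.2 ⟨i, hmem⟩
    have h2 : 0 < ((S.filter fun j => τ j = j).filter fun j => f j = f i).card :=
      Finset.card_pos.2 ⟨i, by simp [hi, h]⟩
    omega
  · have h1 : 1 < (S.filter fun j => f j = f i).card :=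
      Finset.one_lt_card.2 ⟨i, hmem, τ i, by simp [hτ i hi, hf i hi], fun e => h e.symm⟩
    omega

/-- In `ZMod m` the equation `i + i = s` has at most two solutions, and at most one if `m` is
odd. -/
theorem ZMod.card_filter_add_self_eq_le (m : ℕ) [NeZero m] (s : ZMod m) :
    (Finset.univ.filter fun i : ZMod m => i + i = s).card ≤ 2 - m % 2 := by
  rcases Finset.eq_empty_or_nonempty (Finset.univ.filter fun i : ZMod m => i + i = s)
    with h | ⟨j, hj⟩
  · simp [h]
  have hj' : j + j = s := by simpa using hj
  have hle : (Finset.univ.filter fun i : ZMod m => i + i = s).card ≤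
      (Finset.univ.filter fun i : ZMod m => 2 • i = 0).card := by
    refine Finset.card_le_card_of_injOn (fun i => i - j) ?_ (fun a _ b _ h => sub_left_injective h)
    intro i hi
    have hi' : i + i = s := by simpa using hi
    have : 2 • (i - j) = 0 := by
      rw [two_nsmul]
      linear_combination hi' - hj'
    simpa using this
  refine hle.trans ?_
  rcases Nat.even_or_odd m with hm | hm
  · have := IsAddCyclic.card_nsmul_eq_zero_le (α := ZMod m) (n := 2) (by norm_num)
    have h2 := Nat.even_iff.1 hm
    omega
  · have h2 := Nat.odd_iff.1 hm
    rw [h2]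
    refine Finset.card_le_one.2 fun a ha b hb => ?_
    have key : ∀ a : ZMod m, 2 • a = 0 → a = 0 := fun a ha => by
      rw [two_nsmul] at ha
      exact (ZMod.add_self_eq_zero_iff_eq_zero hm).1 ha
    rw [key a (by simpa using ha), key b (by simpa using hb)]

theorem hypVec_comm (m : ℕ) (i j : ZMod m) : hypVec m i j = hypVec m j i := by
  simp only [hypVec, add_comm]

/-- A factorization of coordinate sum three is a triple of atoms. -/
theorem exists_atoms_of_factorization_sum_three {m : ℕ} [NeZero m] {x : ZMod m → ℝ}
    {a : ZMod m} {z : ZMod m → ℕ} (hz : z ∈ KunzFactorizations m x a)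
    (hsum : ∑ c : ZMod m, z c = 3) :
    ∃ p ∈ KunzAtoms m x, ∃ q ∈ KunzAtoms m x, ∃ r ∈ KunzAtoms m x,
      p + q + r = a ∧ x p + x q + x r = x a := by
  obtain ⟨hat, hres, hval⟩ := hz
  set s : Multiset (ZMod m) := ∑ c : ZMod m, z c • {c} with hs
  have hcard : s.card = 3 := by simp [hs, hsum]
  have hmem : ∀ c ∈ s, c ∈ KunzAtoms m x := by
    intro c hc
    obtain ⟨d, -, hd⟩ := Multiset.mem_sum.1 hc
    obtain ⟨h0, hd⟩ := Multiset.mem_nsmul.1 hd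
    rw [Multiset.mem_singleton.1 hd]
    exact hat d h0
  have hsa : s.sum = a := by
    rw [← hres, hs, ← Multiset.coe_sumAddMonoidHom, map_sum]
    simp [Multiset.nsmul_singleton]
  have hsx : (s.map x).sum = x a := by
    rw [← hval, hs, ← Multiset.coe_mapAddMonoidHom, ← Multiset.coe_sumAddMonoidHom, map_sum,
      map_sum]
    simp [Multiset.nsmul_singleton]
  obtain ⟨p, q, r, hpqr⟩ := Multiset.card_eq_three.1 hcard
  rw [hpqr] at hmem hsa hsx
  refine ⟨p, hmem p (by simp), q, hmem q (by simp), r, hmem r (by simp), ?_, ?_⟩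
  · simpa [add_assoc] using hsa
  · simpa [add_assoc] using hsx

/-- If three atoms add up to `a` with equality, then the sum of the first two is a non-atom that
is distinct from `a` and has the expected value. -/
theorem partial_sum_of_atom_triple {m : ℕ} {x : ZMod m → ℝ} (hx : x ∈ KunzCone m)
    (hpos : ∀ i : ZMod m, i ≠ 0 → 0 < x i) {a p q r : ZMod m} (ha : a ≠ 0)
    (hp : p ∈ KunzAtoms m x) (hq : q ∈ KunzAtoms m x) (hr : r ∈ KunzAtoms m x)
    (hs : p + q + r = a) (hv : x p + x q + x r = x a) :
    p + q ≠ 0 ∧ p + q ≠ a ∧ p + q ∉ KunzAtoms m x ∧ a ∉ KunzAtoms m x ∧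
      x (p + q) = x p + x q := by
  have hpq : p + q ≠ 0 := by
    intro h
    rw [h, zero_add] at hs
    rw [hs] at hv
    linarith [hpos p hp.1, hpos q hq.1]
  have h1 := hx p q hp.1 hq.1 hpq
  have h2 := hx (p + q) r hpq hr.1 (hs ▸ ha)
  rw [hs] at h2
  have hval : x (p + q) = x p + x q := by linarith
  refine ⟨hpq, ?_, fun h => h.2 p q hp.1 hq.1 rfl hval.symm,
    fun h => h.2 (p + q) r hpq hr.1 hs (by linarith), hval⟩
  intro h
  rw [h] at hs
  exact hr.1 (by simpa using hs)

/-- When there are only two non-atoms, a factorization of coordinate sum three forces these to be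
`c + c` and `c + c + c` for an atom `c`. -/
theorem exists_atom_of_factorization_sum_three {m : ℕ} [NeZero m] {x : ZMod m → ℝ}
    (hx : x ∈ KunzCone m) (hpos : ∀ i : ZMod m, i ≠ 0 → 0 < x i) (hm : 3 ≤ m)
    (he : kunzE m x = m - 3) {a : ZMod m} (ha : a ≠ 0) {z : ZMod m → ℕ}
    (hz : z ∈ KunzFactorizations m x a) (hsum : ∑ c : ZMod m, z c = 3) :
    ∃ c ∈ KunzAtoms m x, c + c ≠ 0 ∧ c + c + c ≠ 0 ∧ x (c + c) = 2 * x c ∧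
      x (c + c + c) = 3 * x c ∧
      ∀ i : ZMod m, i ≠ 0 → i ∉ KunzAtoms m x → i = c + c ∨ i = c + c + c := by
  classical
  obtain ⟨p, hp, q, hq, r, hr, hs, hv⟩ := exists_atoms_of_factorization_sum_three hz hsum
  obtain ⟨h1, h2, h3, h4, h5⟩ := partial_sum_of_atom_triple hx hpos ha hp hq hr hs hv
  obtain ⟨k1, k2, k3, -, -⟩ := partial_sum_of_atom_triple hx hpos ha hp hr hq
    (by rw [← hs]; ring) (by linarith)
  obtain ⟨l1, l2, l3, -, -⟩ := partial_sum_of_atom_triple hx hpos ha hq hr hp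
    (by rw [← hs]; ring) (by linarith)
  have hN : (Finset.univ.filter fun i : ZMod m => i ≠ 0 ∧ i ∉ KunzAtoms m x).card = 2 := by
    have hA : (Finset.univ.filter fun i : ZMod m => i ∈ KunzAtoms m x).card = m - 3 := by
      rw [← he, kunzE, Set.ncard_eq_toFinset_card']
      congr 1
      ext i
      simp
    have h0 : (0 : ZMod m) ∉ Finset.univ.filter fun i : ZMod m => i ∈ KunzAtoms m x :=
      fun h => (Finset.mem_filter.1 h).2.1 rfl
    have heq : (Finset.univ.filter fun i : ZMod m => i ≠ 0 ∧ i ∉ KunzAtoms m x) =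
        (insert 0 (Finset.univ.filter fun i : ZMod m => i ∈ KunzAtoms m x))ᶜ := by
      ext i
      simp
    rw [heq, Finset.card_compl, ZMod.card, Finset.card_insert_of_notMem h0, hA]
    omega
  have hsub : ({p + q, a} : Finset (ZMod m)) =
      Finset.univ.filter fun i : ZMod m => i ≠ 0 ∧ i ∉ KunzAtoms m x := by
    refine Finset.eq_of_subset_of_card_le ?_ ?_
    · intro i hi
      rcases Finset.mem_insert.1 hi with rfl | hi
      · simp [h1, h3]
      · rw [Finset.mem_singleton.1 hi]
        simp [ha, h4]
    · rw [hN, Finset.card_pair h2]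
  have hall : ∀ i : ZMod m, i ≠ 0 → i ∉ KunzAtoms m x → i = p + q ∨ i = a := by
    intro i hi hi'
    have : i ∈ ({p + q, a} : Finset (ZMod m)) := by
      rw [hsub]
      simp [hi, hi']
    simpa using this
  have hrq : r = q := add_left_cancel ((hall _ k1 k3).resolve_right k2)
  subst hrq
  have hpr : r = p := add_right_cancel ((hall _ l1 l3).resolve_right l2)
  subst hpr
  subst hs
  exact ⟨r, hp, h1, ha, by linarith, by linarith, hall⟩

open Classical in
/-- The atoms `i` such that `s - i` is also an atom and `(i, s - i)` belongs to the equality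
set. -/
noncomputable def atomSummands (m : ℕ) [NeZero m] (x : ZMod m → ℝ) (s : ZMod m) :
    Finset (ZMod m) :=
  Finset.univ.filter fun i => i ∈ KunzAtoms m x ∧ s - i ∈ KunzAtoms m x ∧
    x i + x (s - i) = x s

theorem mem_atomSummands {m : ℕ} [NeZero m] {x : ZMod m → ℝ} {s i : ZMod m} :
    i ∈ atomSummands m x s ↔ i ∈ KunzAtoms m x ∧ s - i ∈ KunzAtoms m x ∧
      x i + x (s - i) = x s := by
  simp [atomSummands]

theorem two_mul_card_image_hypVec_le (m : ℕ) [NeZero m] (x : ZMod m → ℝ) (s : ZMod m) :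
    2 * ((atomSummands m x s).image fun i => hypVec m i (s - i)).card ≤
      (atomSummands m x s).card + (2 - m % 2) := by
  refine (two_mul_card_image_le_of_involution (atomSummands m x s) (fun i => s - i) _
    ?_ ?_).trans (Nat.add_le_add_left ((Finset.card_le_card ?_).trans
      (ZMod.card_filter_add_self_eq_le m s)) _)
  · intro i hi
    obtain ⟨h1, h2, h3⟩ := mem_atomSummands.1 hi
    rw [mem_atomSummands, sub_sub_cancel]
    exact ⟨h2, h1, by linarith⟩
  · intro i _
    rw [sub_sub_cancel, hypVec_comm]
  · intro i hi
    have h : s - i = i := (Finset.mem_filter.1 hi).2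
    simp only [Finset.mem_filter, Finset.mem_univ, true_and]
    linear_combination -h

/-- An atom cannot occur in equalities with both sums `c + c` and `c + c + c`. -/
theorem disjoint_atomSummands {m : ℕ} [NeZero m] {x : ZMod m → ℝ} {c : ZMod m}
    (hc : c ∈ KunzAtoms m x) (h2 : x (c + c) = 2 * x c) (h3 : x (c + c + c) = 3 * x c) :
    Disjoint (atomSummands m x (c + c)) (atomSummands m x (c + c + c)) := by
  refine Finset.disjoint_left.2 fun i hi hi' => ?_
  obtain ⟨-, hj, hij⟩ := mem_atomSummands.1 hi
  obtain ⟨-, hk, hik⟩ := mem_atomSummands.1 hi'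
  exact hk.2 (c + c - i) c hj.1 hc.1 (by ring) (by linarith)

theorem hypVec_mem_of_mem_equalitySet {m : ℕ} [NeZero m] {x : ZMod m → ℝ}
    (hpos : ∀ i : ZMod m, i ≠ 0 → 0 < x i) {c : ZMod m} (hc : c ∈ KunzAtoms m x)
    (h2 : x (c + c) = 2 * x c) (h3 : x (c + c + c) = 3 * x c)
    (hall : ∀ i : ZMod m, i ≠ 0 → i ∉ KunzAtoms m x → i = c + c ∨ i = c + c + c)
    {i j : ZMod m} (hij : (i, j) ∈ EqualitySet m x) :
    hypVec m i j = hypVec m (c + c) c ∨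
      (∃ k ∈ atomSummands m x (c + c), hypVec m k (c + c - k) = hypVec m i j) ∨
      ∃ k ∈ atomSummands m x (c + c + c), hypVec m k (c + c + c - k) = hypVec m i j := by
  obtain ⟨hi, hj, hs, hv⟩ := hij
  dsimp only at hi hj hs hv
  have hxc := hpos c hc.1
  have hxi := hpos i hi
  have hxj := hpos j hj
  rcases hall (i + j) hs (fun h => h.2 i j hi hj rfl hv) with h | h
  · refine Or.inr (Or.inl ⟨i, mem_atomSummands.2 ?_, ?_⟩)
    · rw [← h, add_sub_cancel_left]
      refine ⟨?_, ?_, hv⟩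
      · by_contra hn
        rcases hall i hi hn with e | e <;> rw [h, e] at hv <;> linarith
      · by_contra hn
        rcases hall j hj hn with e | e <;> rw [h, e] at hv <;> linarith
    · rw [← h, add_sub_cancel_left]
  · by_cases hi2 : i = c + c
    · subst hi2
      rw [add_left_cancel h]
      exact Or.inl rfl
    by_cases hj2 : j = c + c
    · subst hj2
      have : i = c := by linear_combination h
      rw [this, hypVec_comm]
      exact Or.inl rfl
    refine Or.inr (Or.inr ⟨i, mem_atomSummands.2 ?_, ?_⟩)
    · rw [← h, add_sub_cancel_left]
      refine ⟨?_, ?_, hv⟩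
      · by_contra hn
        have e := (hall i hi hn).resolve_left hi2
        rw [h, e] at hv
        linarith
      · by_contra hn
        have e := (hall j hj hn).resolve_left hj2
        rw [h, e] at hv
        linarith
    · rw [← h, add_sub_cancel_left]

/-- If `e(x) = m - 3` and some nonzero residue has a factorization of coordinate sum 3,
then `d(x) ≥ ⌊(m-3)/2⌋`. -/
theorem dim_lower_bound_of_coordinate_sum_three (m : ℕ) (hm : 2 ≤ m) [NeZero m]
    (x : ZMod m → ℝ) (hx : x ∈ KunzCone m) (hpos : ∀ i : ZMod m, i ≠ 0 → 0 < x i)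
    (he : kunzE m x = m - 3)
    (hfac : ∃ a : ZMod m, a ≠ 0 ∧ ∃ z ∈ KunzFactorizations m x a,
      ∑ c : ZMod m, z c = 3) :
    (m - 3) / 2 ≤ kunzD m x := by
  classical
  obtain ⟨a, ha, z, hz, hsum⟩ := hfac
  rcases Nat.lt_or_ge m 3 with hm3 | hm3
  · have : (m - 3) / 2 = 0 := by omega
    omega
  obtain ⟨c, hc, -, -, h2, h3, hall⟩ :=
    exists_atom_of_factorization_sum_three hx hpos hm3 he ha hz hsum
  set S₂ := atomSummands m x (c + c) with hS₂
  set S₃ := atomSummands m x (c + c + c) with hS₃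
  set V₂ := S₂.image fun i => hypVec m i (c + c - i) with hV₂
  set V₃ := S₃.image fun i => hypVec m i (c + c + c - i) with hV₃
  have hle₂ : 2 * V₂.card ≤ S₂.card + (2 - m % 2) := two_mul_card_image_hypVec_le m x _
  have hle₃ : 2 * V₃.card ≤ S₃.card + (2 - m % 2) := two_mul_card_image_hypVec_le m x _
  have hS : S₂.card + S₃.card ≤ m - 3 := by
    rw [← Finset.card_union_of_disjoint (disjoint_atomSummands hc h2 h3), ← he, kunzE,
      ← Set.ncard_coe_finset]
    refine Set.ncard_le_ncard (fun i hi => ?_) (Set.toFinite _)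
    rcases Finset.mem_union.1 (Finset.mem_coe.1 hi) with hi | hi
    · exact (mem_atomSummands.1 hi).1
    · exact (mem_atomSummands.1 hi).1
  have hrank : Module.finrank ℚ (Submodule.span ℚ
      {v : ZMod m → ℚ | ∃ p ∈ EqualitySet m x, v = hypVec m p.1 p.2}) ≤
      V₂.card + V₃.card + 1 := by
    have hsub : {v : ZMod m → ℚ | ∃ p ∈ EqualitySet m x, v = hypVec m p.1 p.2} ⊆
        ((insert (hypVec m (c + c) c) (V₂ ∪ V₃) : Finset (ZMod m → ℚ)) :
          Set (ZMod m → ℚ)) := by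
      rintro v ⟨⟨i, j⟩, hij, rfl⟩
      rw [Finset.mem_coe, Finset.mem_insert, Finset.mem_union, hV₂, hV₃, Finset.mem_image,
        Finset.mem_image]
      exact hypVec_mem_of_mem_equalitySet hpos hc h2 h3 hall hij
    exact (Submodule.finrank_mono (Submodule.span_mono hsub)).trans
      ((finrank_span_finset_le_card _).trans ((Finset.card_insert_le _ _).trans
        (Nat.add_le_add_right (Finset.card_union_le _ _) 1)))
  unfold kunzD
  omega
end

section
/- Fix an integer m ≥ 7 and a point x ∈ C_m all of whose coordinates are positive. If e(x) = m − 1, then d(x) = m − 1. -/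
open scoped BigOperators

/-- For `m ≥ 7`: if `e(x) = m - 1` then `d(x) = m - 1`. -/
theorem dim_eq_of_embdim_eq_m_sub_one (m : ℕ) (hm : 7 ≤ m) [NeZero m]
    (x : ZMod m → ℝ) (hx : x ∈ KunzCone m) (hpos : ∀ i : ZMod m, i ≠ 0 → 0 < x i)
    (he : kunzE m x = m - 1) :
    kunzD m x = m - 1 := by
  have hatoms : KunzAtoms m x = {0}ᶜ := by
    refine Set.eq_of_subset_of_ncard_le (fun a ha => ha.1) ?_ (Set.toFinite _)
    rw [Set.ncard_compl, Set.ncard_singleton, Nat.card_zmod]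
    exact he.ge
  have hempty : {v : ZMod m → ℚ | ∃ p ∈ EqualitySet m x, v = hypVec m p.1 p.2} = ∅ := by
    refine Set.eq_empty_of_forall_notMem ?_
    rintro v ⟨⟨i, j⟩, ⟨hi, hj, hij, heq⟩, -⟩
    have hmem : i + j ∈ KunzAtoms m x := hatoms ▸ hij
    exact hmem.2 i j hi hj rfl heq
  rw [kunzD, hempty, Submodule.span_empty, finrank_bot, Nat.sub_zero]
end

section
/- Fix an integer m ≥ 7 and a point x ∈ C_m all of whose coordinates are positive. If e(x) = m − 2 and m = 2(d(x) + 1) (that is, d(x) = m/2 − 1, which forces m to be even), then there is no Apéry point y of C_m with E(y) = E(x). -/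
open scoped BigOperators

/-- If all but one of the nonzero residues are atoms, then all equalities have the same
right-hand side. -/
theorem exists_add_eq_of_mem_equalitySet {m : ℕ} (hm : 2 ≤ m) {x : ZMod m → ℝ}
    (he : kunzE m x = m - 2) :
    ∃ w : ZMod m, w ≠ 0 ∧ ∀ p ∈ EqualitySet m x, p.1 + p.2 = w := by
  have : NeZero m := ⟨by omega⟩
  have hsub : KunzAtoms m x ⊆ {0}ᶜ := fun a ha => ha.1
  have hcard : ({0}ᶜ \ KunzAtoms m x : Set (ZMod m)).ncard = 1 := by
    rw [Set.ncard_sdiff hsub, Set.ncard_compl, Nat.card_zmod, Set.ncard_singleton]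
    unfold kunzE at he
    omega
  obtain ⟨w, hw⟩ := Set.ncard_eq_one.1 hcard
  have hw' : w ∈ ({0}ᶜ \ KunzAtoms m x : Set (ZMod m)) := hw ▸ rfl
  refine ⟨w, hw'.1, fun p ⟨h1, h2, h3, h4⟩ => ?_⟩
  have hp : p.1 + p.2 ∈ ({0}ᶜ \ KunzAtoms m x : Set (ZMod m)) :=
    ⟨h3, fun h => h.2 p.1 p.2 h1 h2 rfl h4⟩
  rw [hw] at hp
  exact hp

open Classical in
/-- If all equalities have right-hand side `w`, the rank of their normal vectors is at most the
number of orbits of `i ↦ w - i` on `ℤ/m ∖ {0, w}` which occur in the equality set. -/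
theorem two_mul_finrank_span_hypVec_add_two_le {m : ℕ} [NeZero m] {x : ZMod m → ℝ} {w : ZMod m}
    (hw0 : w ≠ 0) (hw : ∀ p ∈ EqualitySet m x, p.1 + p.2 = w) :
    2 * Module.finrank ℚ (Submodule.span ℚ
      {v : ZMod m → ℚ | ∃ p ∈ EqualitySet m x, v = hypVec m p.1 p.2}) + 2 ≤
      m + (Finset.univ.filter fun i : ZMod m => (i, i) ∈ EqualitySet m x).card := by
  have hsymm : ∀ i j, (i, j) ∈ EqualitySet m x → (j, i) ∈ EqualitySet m x := by
    rintro i j ⟨h1, h2, h3, h4⟩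
    exact ⟨h2, h1, by rwa [add_comm] at h3, by simpa only [add_comm] using h4⟩
  set S := Finset.univ.filter fun i : ZMod m => (i, w - i) ∈ EqualitySet m x with hS
  set A := S.filter fun i => i.val ≤ (w - i).val with hA
  set B := S.filter fun i => (w - i).val ≤ i.val with hB
  have hAB : A.card = B.card := by
    refine Finset.card_bij' (fun i _ => w - i) (fun i _ => w - i) ?_ ?_ ?_ ?_
    · intro i hi
      simp only [hA, hB, hS, Finset.mem_filter, Finset.mem_univ, true_and, sub_sub_cancel] at hi ⊢
      exact ⟨hsymm _ _ hi.1, hi.2⟩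
    · intro i hi
      simp only [hA, hB, hS, Finset.mem_filter, Finset.mem_univ, true_and, sub_sub_cancel] at hi ⊢
      exact ⟨hsymm _ _ hi.1, hi.2⟩
    · simp
    · simp
  have hunion : A ∪ B = S := by
    rw [hA, hB, ← Finset.filter_or, Finset.filter_true_of_mem]
    exact fun i _ => le_total _ _
  have hinter : A ∩ B ⊆ Finset.univ.filter fun i : ZMod m => (i, i) ∈ EqualitySet m x := by
    intro i hi
    simp only [hA, hB, hS, Finset.mem_inter, Finset.mem_filter, Finset.mem_univ, true_and] at hi ⊢
    have h : i = w - i := ZMod.val_injective m (le_antisymm hi.1.2 hi.2.2)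
    simpa only [← h] using hi.1.1
  have hScard : S.card + 2 ≤ m := by
    have hle : S ⊆ ({0, w} : Finset (ZMod m))ᶜ := by
      intro i hi
      obtain ⟨h1, h2, -, -⟩ := (Finset.mem_filter.1 hi).2
      simp only [Finset.mem_compl, Finset.mem_insert, Finset.mem_singleton, not_or]
      exact ⟨h1, fun h => h2 (by simp [h])⟩
    have h2 := Finset.card_le_card hle
    have h3 := Finset.card_add_card_compl ({0, w} : Finset (ZMod m))
    rw [Finset.card_pair hw0.symm, ZMod.card] at h3
    omega
  have hspan : {v : ZMod m → ℚ | ∃ p ∈ EqualitySet m x, v = hypVec m p.1 p.2} ⊆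
      (A.image fun i => hypVec m i (w - i) : Finset (ZMod m → ℚ)) := by
    rintro v ⟨⟨i, j⟩, hp, rfl⟩
    have hj : j = w - i := eq_sub_of_add_eq' (hw _ hp)
    have hi : i = w - j := eq_sub_of_add_eq (hw _ hp)
    simp only [Finset.coe_image, Set.mem_image, Finset.mem_coe, hA, hS, Finset.mem_filter,
      Finset.mem_univ, true_and]
    rcases le_total i.val j.val with h | h
    · exact ⟨i, by rw [← hj]; exact ⟨hp, h⟩, by rw [← hj]⟩
    · refine ⟨j, by rw [← hi]; exact ⟨hsymm _ _ hp, h⟩, ?_⟩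
      rw [← hi]
      simp only [hypVec, add_comm]
  have hrank : Module.finrank ℚ (Submodule.span ℚ
      {v : ZMod m → ℚ | ∃ p ∈ EqualitySet m x, v = hypVec m p.1 p.2}) ≤ A.card :=
    (Submodule.finrank_mono (Submodule.span_mono hspan)).trans
      ((finrank_span_finset_le_card _).trans Finset.card_image_le)
  have h1 := Finset.card_union_add_card_inter A B
  have h2 := Finset.card_le_card hinter
  rw [hunion] at h1
  omega

/-- For `m ≥ 7`: if `e(x) = m - 2` and `d(x) = m/2 - 1` (i.e. `m = 2(d(x) + 1)`, forcing
`m` even), then the face containing `x` is not Apéry. -/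
theorem not_apery_of_embdim_m_sub_two_min_dim (m : ℕ) (hm : 7 ≤ m) [NeZero m]
    (x : ZMod m → ℝ) (hx : x ∈ KunzCone m) (hpos : ∀ i : ZMod m, i ≠ 0 → 0 < x i)
    (he : kunzE m x = m - 2) (hd : m = 2 * (kunzD m x + 1)) :
    ¬ ∃ y, IsAperyPoint m y ∧ EqualitySet m y = EqualitySet m x := by
  classical
  rintro ⟨y, ⟨-, hint⟩, hE⟩
  obtain ⟨w, hw0, hw⟩ := exists_add_eq_of_mem_equalitySet (by omega) he
  have hrank := two_mul_finrank_span_hypVec_add_two_le hw0 hw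
  have hcard : 1 < (Finset.univ.filter fun i : ZMod m => (i, i) ∈ EqualitySet m x).card := by
    unfold kunzD at hd
    omega
  obtain ⟨a, ha, b, hb, hab⟩ := Finset.one_lt_card.1 hcard
  replace ha := (Finset.mem_filter.1 ha).2
  replace hb := (Finset.mem_filter.1 hb).2
  have hwa : a + a = w := hw _ ha
  have hwb : b + b = w := hw _ hb
  rw [← hE] at ha hb
  obtain ⟨ha0, -, -, hya⟩ := ha
  obtain ⟨hb0, -, -, hyb⟩ := hb
  obtain ⟨s, hs, hsa⟩ := hint a ha0
  obtain ⟨t, ht, htb⟩ := hint b hb0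
  simp only [hwa, hwb] at hya hyb
  have hst : (s : ℝ) = t := by linarith
  exact hab (by rw [← hsa, ← htb, Int.cast_injective hst])
end
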